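/- (GCK via the dual Radon transform) Let Ω₀ ⊆ ℝ^{p+1} be a domain and f₀ : Ω₀ → ℝ_{p+q} real analytic. Then for all 𝐱 in a p-symmetric slice domain Ω ⊆ Ω₀* containing Ω₀: GCK[f₀](𝐱) = (1/A_q) ∫_𝕊 CK[f₀, η](𝐱) dS(η) = \check{R}[ CK[f₀] ](𝐱); that is, GCK = \check{R} ∘ CK, and in particular the dual Radon transform maps the slice CK-extension CK[f₀] ∈ 𝒢𝒮ℳ(Ω) to the axially monogenic generalized CK-extension GCK[f₀]. -/

import Mathlib

/-!
Common framework for generalized partial-slice monogenic functions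
(Xu–Sabadini, "On the Fueter-Sce theorem for generalized partial-slice
monogenic functions").

The real Clifford algebra `ℝ_{p+q}` is formalized as the Mathlib Clifford
algebra of the negative-definite quadratic form on `ℝ^{p+q}`; since Mathlib
provides no canonical norm on it, all analytic statements are phrased for an
arbitrary normed real algebra `A` together with an `ℝ`-algebra isomorphism
`ξ : A ≃ₐ[ℝ] Cl (p+q)`.  A point of `ℝ^{p+q+1}` is a pair
`(𝐱_p, 𝐱_q) : (Fin (p+1) → ℝ) × EuclideanSpace ℝ (Fin q)`, and a point of a
slice `ℝ^{p+2}` is a pair `(𝐱_p, r)`.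
-/

noncomputable section

open Filter Topology MeasureTheory Metric
open scoped Nat RealInnerProductSpace

namespace GPS

/-- The negative definite quadratic form `-(x₁² + ⋯ + xₙ²)` on `ℝⁿ`. -/
def Qe (n : ℕ) : QuadraticForm ℝ (Fin n → ℝ) :=
  QuadraticMap.weightedSumSquares ℝ (fun _ : Fin n => (-1 : ℝ))

/-- The real Clifford algebra `ℝ_n`. -/
abbrev Cl (n : ℕ) : Type := CliffordAlgebra (Qe n)

/-- The generators `e_1, …, e_n` of `ℝ_n` (indexed by `Fin n`). -/
def e (n : ℕ) (i : Fin n) : Cl n := CliffordAlgebra.ι (Qe n) (Pi.single i 1)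

variable (p q : ℕ)

/-- `ℝ^{p+1}`, the "slice-axis" space. -/
abbrev Vp : Type := Fin (p + 1) → ℝ

/-- `ℝ^q`. -/
abbrev Vq : Type := EuclideanSpace ℝ (Fin q)

/-- `ℝ^{p+q+1} = ℝ^{p+1} ⊕ ℝ^q`. -/
abbrev V : Type := Vp p × Vq q

/-- `ℝ^{p+2}`, the parameter space `(𝐱_p, r)` of a slice. -/
abbrev Sl : Type := Vp p × ℝ

/-- The sphere `𝕊` of unit 1-vectors, described by their coordinate vectors
`(x_{p+1}, …, x_{p+q}) ∈ ℝ^q` with `∑ x_i² = 1`. -/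
def S : Set (Vq q) := {v | ∑ j, v j ^ 2 = 1}

/-- The point `𝐱_p + r ω` of `ℝ^{p+q+1}`. -/
def spt (v : Vq q) (z : Sl p) : V p q := (z.1, z.2 • v)

/-- The (parameterized) slice `Ω_ω` of a set `Ω ⊆ ℝ^{p+q+1}`. -/
def sliceSet (Ω : Set (V p q)) (v : Vq q) : Set (Sl p) := {z | spt p q v z ∈ Ω}

/-- `Ω₀* = {𝐱_p + 𝐱_q : 𝐱_p ∈ Ω₀, 𝐱_q ∈ ℝ^q}`. -/
def star0 (Ω₀ : Set (Vp p)) : Set (V p q) := {z | z.1 ∈ Ω₀}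

/-- The p-symmetric completion `Ω_D` of a set `D ⊆ ℝ^{p+2}`. -/
def completion (D : Set (Sl p)) : Set (V p q) :=
  {x | ∃ z ∈ D, ∃ v ∈ S q, x = spt p q v z}

/-- `D` is invariant under the reflection of the `(p+2)`-th variable. -/
def ReflInv (D : Set (Sl p)) : Prop := ∀ z ∈ D, ((z.1, -z.2) : Sl p) ∈ D

/-- A domain: a nonempty open connected set. -/
def IsDomain {E : Type*} [TopologicalSpace E] (s : Set E) : Prop :=
  IsOpen s ∧ IsConnected s

/-- A slice domain. -/
def IsSliceDomain (Ω : Set (V p q)) : Prop :=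
  IsDomain Ω ∧ (∃ x : Vp p, ((x, 0) : V p q) ∈ Ω) ∧
    ∀ v ∈ S q, IsDomain (sliceSet p q Ω v)

/-- Partial symmetry with respect to `ℝ^{p+1}`. -/
def IsPSymmetric (Ω : Set (V p q)) : Prop :=
  ∀ (x : Vp p) (r : ℝ), ∀ v ∈ S q, ∀ w ∈ S q,
    ((x, r • v) : V p q) ∈ Ω → ((x, r • w) : V p q) ∈ Ω

/-- A `d`-dimensional smooth submanifold of a real normed space. -/
def IsSmoothSubmanifoldDim {E : Type*} [NormedAddCommGroup E] [NormedSpace ℝ E]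
    (d : ℕ) (M : Set E) : Prop :=
  ∀ x ∈ M, ∃ U : Set E, IsOpen U ∧ x ∈ U ∧
    ∃ (ψ : (Fin d → ℝ) → E) (W : Set (Fin d → ℝ)), IsOpen W ∧
      ContDiffOn ℝ (⊤ : ℕ∞) ψ W ∧ Set.InjOn ψ W ∧
      (∀ y ∈ W, Function.Injective (fderivWithin ℝ ψ W y)) ∧
      M ∩ U = ψ '' W

variable {A : Type*} [NormedRing A] [NormedAlgebra ℝ A] (ξ : A ≃ₐ[ℝ] Cl (p + q))

/-- The generators `e_1, …, e_{p+q}` inside `A`. -/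
def gen (i : Fin (p + q)) : A := ξ.symm (e (p + q) i)

/-- The generators `e_{p+1}, …, e_{p+q}` (the "q-part"). -/
def eQ (j : Fin q) : A := gen p q ξ ⟨p + (j : ℕ), by have := j.isLt; omega⟩

/-- The generators `e_1, …, e_p` (the "p-part", without `e_0 = 1`). -/
def eP (i : Fin p) : A := gen p q ξ ⟨(i : ℕ), by have := i.isLt; omega⟩

/-- `e_0 = 1, e_1, …, e_p`: the paravector basis of `ℝ^{p+1}` inside `A`. -/
def εp (i : Fin (p + 1)) : A :=
  if h : (i : ℕ) = 0 then 1 else gen p q ξ ⟨(i : ℕ) - 1, by have := i.isLt; omega⟩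

/-- The 1-vector `∑ x_i e_{p+i} ∈ A` corresponding to `𝐱_q ∈ ℝ^q`;
for a unit `v` this is the imaginary unit `ω ∈ 𝕊`. -/
def ωCl (v : Vq q) : A := ∑ j, v j • eQ p q ξ j

/-- The paravector `x_0 + x_1 e_1 + ⋯ + x_p e_p ∈ A` of `𝐱_p ∈ ℝ^{p+1}`. -/
def clP (x : Vp p) : A := ∑ i, x i • εp p q ξ i

/-- The paravector of `𝐱 ∈ ℝ^{p+q+1}` in `A`. -/
def toCl (z : V p q) : A := clP p q ξ z.1 + ωCl p q ξ z.2

section SliceOperators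

variable {F' : Type*} [NormedAddCommGroup F'] [NormedSpace ℝ F']

/-- `∂_{x_i}` on functions on `ℝ^{p+2}`. -/
def pdSl (i : Fin (p + 1)) (F : Sl p → F') : Sl p → F' :=
  fun z => fderiv ℝ F z (Pi.single i 1, 0)

/-- `∂_r` on functions on `ℝ^{p+2}`. -/
def pdr (F : Sl p → F') : Sl p → F' := fun z => fderiv ℝ F z (0, 1)

/-- `∂_{x_i}` (first factor) on functions on `ℝ^{p+q+1}`. -/
def pdV1 (i : Fin (p + 1)) (f : V p q → F') : V p q → F' :=
  fun z => fderiv ℝ f z ((Pi.single i 1 : Vp p), 0)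

/-- `∂_{x_{p+j}}` (second factor) on functions on `ℝ^{p+q+1}`. -/
def pdV2 (j : Fin q) (f : V p q → F') : V p q → F' :=
  fun z => fderiv ℝ f z (0, EuclideanSpace.single j 1)

/-- `∂_{x_i}` on functions on `ℝ^{p+1}`. -/
def pdP (i : Fin (p + 1)) (g : Vp p → F') : Vp p → F' :=
  fun x => fderiv ℝ g x (Pi.single i 1)

/-- The Laplacian `Δ_{𝐱'} = Δ_{𝐱_p} + ∂_r²` on `ℝ^{p+2}`. -/
def LapSl (F : Sl p → F') : Sl p → F' :=
  fun z => ∑ i, pdSl p (i := i) (pdSl p i F) z + pdr p (pdr p F) z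

/-- The Laplacian `Δ_𝐱` on `ℝ^{p+q+1}`. -/
def LapV (f : V p q → F') : V p q → F' :=
  fun z => ∑ i, pdV1 p q i (pdV1 p q i f) z + ∑ j, pdV2 p q j (pdV2 p q j f) z

/-- The Laplacian `Δ_{𝐱_p}` on `ℝ^{p+1}`. -/
def LapP (g : Vp p → F') : Vp p → F' :=
  fun x => ∑ i, pdP p i (pdP p i g) x

end SliceOperators

/-- The generalized Cauchy–Riemann operator `D_{𝐱_p} = ∑_{i=0}^p e_i ∂_{x_i}`
on slice functions. -/
def DP (F : Sl p → A) : Sl p → A :=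
  fun z => ∑ i, εp p q ξ i * pdSl p i F z

/-- The conjugated operator `D̄_{𝐱_p} = ∂_{x_0} - ∑_{i=1}^p e_i ∂_{x_i}`. -/
def DPbar (F : Sl p → A) : Sl p → A :=
  fun z => pdSl p 0 F z - ∑ i : Fin p, eP p q ξ i * pdSl p i.succ F z

/-- The generalized Cauchy–Riemann (Dirac) operator `D_𝐱` on `ℝ^{p+q+1}`. -/
def DV (f : V p q → A) : V p q → A :=
  fun z => ∑ i, εp p q ξ i * pdV1 p q i f z + ∑ j, eQ p q ξ j * pdV2 p q j f z

/-- `D_{𝐱_p} = ∑_{i=0}^p e_i ∂_{x_i}` on functions on `ℝ^{p+1}`. -/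
def DPfun (g : Vp p → A) : Vp p → A :=
  fun x => ∑ i, εp p q ξ i * pdP p i g x

/-- The slice operator `D_ω = D_{𝐱_p} + ω ∂_r`, expressed on `ℝ^{p+q+1} ∖ ℝ^{p+1}`
(at `𝐱_q = 0` the radial part is junk `0`). -/
def Dslice (f : V p q → A) : V p q → A :=
  fun z => ∑ i, εp p q ξ i * pdV1 p q i f z
    + ωCl p q ξ (‖z.2‖⁻¹ • z.2) * fderiv ℝ f z (0, ‖z.2‖⁻¹ • z.2)

/-- The spherical Dirac operator `Γ = -∑_{i<j} e_i e_j L_{ij}` on the `ℝ^q` variables. -/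
def sphericalDirac (f : V p q → A) : V p q → A :=
  fun z => - ∑ i : Fin q, ∑ j : Fin q,
    if (i : ℕ) < (j : ℕ) then
      eQ p q ξ i * eQ p q ξ j *
        (z.2 i • pdV2 p q j f z - z.2 j • pdV2 p q i f z)
    else 0

/-- `f` is left generalized partial-slice monogenic of type `(p,q)` on `Ω`. -/
def GSMOn (Ω : Set (V p q)) (f : V p q → A) : Prop :=
  ∀ v ∈ S q,
    ContDiffOn ℝ 1 (fun z => f (spt p q v z)) (sliceSet p q Ω v) ∧
    ∀ z ∈ sliceSet p q Ω v,
      DP p q ξ (fun w => f (spt p q v w)) z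
        + ωCl p q ξ v * pdr p (fun w => f (spt p q v w)) z = 0

/-- `f` is (left) monogenic on `Ω`. -/
def MonogenicOn (Ω : Set (V p q)) (f : V p q → A) : Prop :=
  ContDiffOn ℝ 1 f Ω ∧ ∀ z ∈ Ω, DV p q ξ f z = 0

/-- `f` is the generalized partial-slice function on `Ω_D` with components `F1, F2`
(an even–odd pair in the last variable). -/
def IsGPSlice (D : Set (Sl p)) (f : V p q → A) (F1 F2 : Sl p → A) : Prop :=
  (∀ z ∈ D, F1 (z.1, -z.2) = F1 z ∧ F2 (z.1, -z.2) = -F2 z) ∧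
  ∀ z ∈ D, ∀ v ∈ S q, f (spt p q v z) = F1 z + ωCl p q ξ v * F2 z

/-- The generalized Cauchy–Riemann system (2.6) for the pair `(F1, F2)`. -/
def CRSystem (D : Set (Sl p)) (F1 F2 : Sl p → A) : Prop :=
  ∀ z ∈ D, DP p q ξ F1 z - pdr p F2 z = 0 ∧ DPbar p q ξ F2 z + pdr p F1 z = 0

/-- `f ∈ 𝒢𝒮ℛ(Ω_D)` with the given components. -/
def GSROnWith (D : Set (Sl p)) (f : V p q → A) (F1 F2 : Sl p → A) : Prop :=
  IsGPSlice p q ξ D f F1 F2 ∧ ContDiffOn ℝ 1 F1 D ∧ ContDiffOn ℝ 1 F2 D ∧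
    CRSystem p q ξ D F1 F2

/-- `f ∈ 𝒢𝒮ℛ(Ω_D)`. -/
def GSROn (D : Set (Sl p)) (f : V p q → A) : Prop :=
  ∃ F1 F2, GSROnWith p q ξ D f F1 F2

/-- Iterates `((1/r) ∂_r)^k F`. -/
def AIter (F : Sl p → A) : ℕ → Sl p → A
  | 0 => F
  | k + 1 => fun z => z.2⁻¹ • pdr p (AIter F k) z

/-- Iterates `(∂_r (1/r))^k F`. -/
def BIter (F : Sl p → A) : ℕ → Sl p → A
  | 0 => F
  | k + 1 => fun z => fderiv ℝ (fun w : Sl p => w.2⁻¹ • BIter F k w) z (0, 1)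

/-- `C_q(k) = (q-1)(q-3)⋯(q-2k+1)`. -/
def Cq (k : ℕ) : ℝ := ∏ j ∈ Finset.range k, ((q : ℝ) - (2 * (j : ℝ) + 1))

/-- The Fueter–Sce map `τ_q = (1/(q-1)!!) Δ^{(q-1)/2}` (for odd `q`). -/
def tauq (f : V p q → A) : V p q → A :=
  fun z => (((q - 1)‼ : ℝ))⁻¹ • (LapV p q)^[(q - 1) / 2] f z

/-- `(𝐱_q D_{𝐱_p})^k`, for a fixed Clifford element `u` in place of `𝐱_q`. -/
def uDpow (u : A) : ℕ → (Vp p → A) → Vp p → A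
  | 0 => fun g => g
  | k + 1 => fun g x => u * DPfun p q ξ (uDpow u k g) x

/-- The `k`-th term of the slice Cauchy–Kovalevskaya extension series. -/
def ckTerm (f₀ : Vp p → A) (k : ℕ) (z : V p q) : A :=
  ((k ! : ℝ))⁻¹ • uDpow p q ξ (ωCl p q ξ z.2) k f₀ z.1

/-- The slice Cauchy–Kovalevskaya extension `CK[f₀]`. -/
def CKext (f₀ : Vp p → A) (z : V p q) : A := ∑' k, ckTerm p q ξ f₀ k z

/-- The `k`-th term of the CK-extension for a fixed direction `w`. -/
def ckDirTerm (w : Vq q) (f₀ : Vp p → A) (k : ℕ) (z : V p q) : A :=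
  ((⟪w, z.2⟫) ^ k / (k ! : ℝ)) • uDpow p q ξ (ωCl p q ξ w) k f₀ z.1

/-- The CK-extension for a fixed direction `w ∈ 𝕊`. -/
def CKdir (w : Vq q) (f₀ : Vp p → A) (z : V p q) : A :=
  ∑' k, ckDirTerm p q ξ w f₀ k z

/-- The coefficients of the generalized CK-extension:
`f_{2k} = (Γ(q/2) / (2^{2k} k! Γ(k+q/2))) Δ^k f₀` and
`f_{2k+1} = (Γ(q/2) / (2^{2k+1} k! Γ(k+q/2+1))) D Δ^k f₀`. -/
def gckCoeff (f₀ : Vp p → A) (k : ℕ) : Vp p → A :=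
  if k % 2 = 0 then
    fun x => (Real.Gamma ((q : ℝ) / 2) /
        (2 ^ k * ((k / 2)! : ℝ) * Real.Gamma (((k / 2 : ℕ) : ℝ) + (q : ℝ) / 2))) •
      (LapP p)^[k / 2] f₀ x
  else
    fun x => (Real.Gamma ((q : ℝ) / 2) /
        (2 ^ k * ((k / 2)! : ℝ) * Real.Gamma (((k / 2 : ℕ) : ℝ) + (q : ℝ) / 2 + 1))) •
      DPfun p q ξ ((LapP p)^[k / 2] f₀) x

/-- The `k`-th term `𝐱_q^k f_k(𝐱_p)` of the generalized CK-extension series. -/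
def gckTerm (f₀ : Vp p → A) (k : ℕ) (z : V p q) : A :=
  (ωCl p q ξ z.2) ^ k * gckCoeff p q ξ f₀ k z.1

/-- The generalized CK-extension `GCK[f₀]`. -/
def GCKext (f₀ : Vp p → A) (z : V p q) : A := ∑' k, gckTerm p q ξ f₀ k z

/-- The Radon transform `R[f](𝐱_p, r, ω) = ∫_{⟨𝐱_q,ω⟩=r} f(𝐱_p, 𝐱_q) dσ(𝐱_q)`. -/
def radon (f : V p q → A) (x : Vp p) (r : ℝ) (w : Vq q) : A :=
  ∫ u : ((Submodule.span ℝ {w})ᗮ : Submodule ℝ (Vq q)),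
    f (x, r • w + (u : Vq q))

/-- The (suitably normalized) surface measure on the unit sphere of `ℝ^q`. -/
def sphMeasure : Measure (sphere (0 : Vq q) 1) := volume.toSphere

/-- The dual Radon transform
`Ř[f](𝐱_p, 𝐱_q) = (1/A_q) ∫_𝕊 f(𝐱_p, ⟨𝐱_q, η⟩ η) dS(η)` (a spherical average). -/
def dualRadon (f : V p q → A) (z : V p q) : A :=
  ⨍ w : sphere (0 : Vq q) 1,
    f (z.1, (⟪((w : Vq q)), z.2⟫) • (w : Vq q)) ∂(sphMeasure q)

end GPS

open GPS

namespace GPS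

section

theorem integral_homogeneous_mul_exp {E : Type*} [NormedAddCommGroup E] [NormedSpace ℝ E]
    [Nontrivial E] [FiniteDimensional ℝ E] [MeasurableSpace E] [BorelSpace E] (μ : Measure E)
    [μ.IsAddHaarMeasure] (Φ : E → ℝ) (n : ℕ)
    (hΦ : ∀ (r : ℝ) (w : E), Φ (r • w) = r ^ n * Φ w) :
    ∫ x, Φ x * Real.exp (-‖x‖ ^ 2) ∂μ =
      (∫ w : sphere (0 : E) 1, Φ w ∂μ.toSphere) *
        (Real.Gamma (((n + Module.finrank ℝ E : ℕ) : ℝ) / 2) / 2) := by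
  have hd : 0 < Module.finrank ℝ E := Module.finrank_pos
  set d := Module.finrank ℝ E with hd_def
  calc
    _ = ∫ x : ({(0)}ᶜ : Set E), Φ x * Real.exp (-‖x.1‖ ^ 2) ∂(μ.comap (↑)) := by
      rw [integral_subtype_comap (measurableSet_singleton _).compl
        fun x ↦ Φ x * Real.exp (-‖x‖ ^ 2), restrict_compl_singleton]
    _ = ∫ z, Φ z.1 * ((z.2 : ℝ) ^ n * Real.exp (-(z.2 : ℝ) ^ 2))
          ∂μ.toSphere.prod (.volumeIoiPow (d - 1)) := by
      rw [← μ.measurePreserving_homeomorphUnitSphereProd.integral_comp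
        (Homeomorph.measurableEmbedding _)]
      refine integral_congr_ae (.of_forall fun x => ?_)
      have hx : ‖(x : E)‖ ≠ 0 := norm_ne_zero_iff.2 x.2
      have h := hΦ ‖(x : E)‖ (‖(x : E)‖⁻¹ • (x : E))
      rw [smul_inv_smul₀ hx] at h
      simp only [homeomorphUnitSphereProd_apply_snd_coe, homeomorphUnitSphereProd_apply_fst_coe]
      rw [h]; ring
    _ = (∫ w : sphere (0 : E) 1, Φ w ∂μ.toSphere) *
          ∫ y : Set.Ioi (0 : ℝ), ((y : ℝ) ^ n * Real.exp (-(y : ℝ) ^ 2))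
            ∂.volumeIoiPow (d - 1) :=
      integral_prod_mul (fun w : sphere (0 : E) 1 => Φ w)
        (fun y : Set.Ioi (0 : ℝ) => (y : ℝ) ^ n * Real.exp (-(y : ℝ) ^ 2))
    _ = _ := by
      congr 1
      have h2 := integral_rpow_mul_exp_neg_rpow (p := 2) (q := ((n + d - 1 : ℕ) : ℝ)) two_pos
        (by have : (0 : ℝ) ≤ ((n + d - 1 : ℕ) : ℝ) := Nat.cast_nonneg _
            linarith)
      have h3 : (((n + d - 1 : ℕ) : ℝ) + 1) = ((n + d : ℕ) : ℝ) := by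
        rw [← Nat.cast_add_one]; congr 1; omega
      rw [h3] at h2
      rw [div_eq_inv_mul, ← one_div, ← h2]
      simp only [Measure.volumeIoiPow, ENNReal.ofReal]
      rw [integral_withDensity_eq_integral_smul,
        integral_subtype_comap measurableSet_Ioi fun a ↦
          Real.toNNReal (a ^ (d - 1)) • (a ^ n * Real.exp (-a ^ 2)),
        setIntegral_congr_fun measurableSet_Ioi fun x hx ↦ ?_]
      · have hx' : (0 : ℝ) < x := hx
        rw [NNReal.smul_def, Real.coe_toNNReal _ (pow_nonneg hx'.le _), Real.rpow_natCast,
          Real.rpow_two, smul_eq_mul, ← mul_assoc, ← pow_add]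
        congr 2; omega
      · exact (measurable_subtype_coe.pow_const _).real_toNNReal

theorem integral_even_pow_mul_exp (m : ℕ) :
    ∫ x : ℝ, x ^ (2 * m) * Real.exp (-x ^ 2) = Real.Gamma ((m : ℝ) + 1 / 2) := by
  have h := integral_comp_abs (f := fun x : ℝ => x ^ (2 * m) * Real.exp (-x ^ 2))
  simp only [pow_mul, sq_abs] at h
  have h2 := integral_rpow_mul_exp_neg_rpow (p := 2) (q := ((2 * m : ℕ) : ℝ)) two_pos
        (by have : (0 : ℝ) ≤ ((2 * m : ℕ) : ℝ) := Nat.cast_nonneg _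
            linarith)
  simp only [Real.rpow_natCast, Real.rpow_two, pow_mul] at h2
  simp only [pow_mul]
  rw [h, h2]
  push_cast
  rw [show (2 * (m : ℝ) + 1) / 2 = m + 1 / 2 by ring]; ring

variable {q : ℕ}

theorem integral_inner_pow_mul_exp [NeZero q] (m : ℕ) (y : Vq q) :
    ∫ x : Vq q, ⟪x, y⟫ ^ (2 * m) * Real.exp (-‖x‖ ^ 2) =
      ‖y‖ ^ (2 * m) * (Real.Gamma ((m : ℝ) + 1 / 2) * Real.Gamma (1 / 2) ^ (q - 1)) := by
  have key : ∫ x : Vq q, (x 0) ^ (2 * m) * Real.exp (-‖x‖ ^ 2) =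
      Real.Gamma ((m : ℝ) + 1 / 2) * Real.Gamma (1 / 2) ^ (q - 1) := by
    have h1 := (EuclideanSpace.volume_preserving_symm_measurableEquiv_toLp (Fin q)).integral_comp'
      (fun x : Fin q → ℝ => (x 0) ^ (2 * m) * Real.exp (-∑ i, x i ^ 2))
    have h2 := integral_fintype_prod_volume_eq_prod (𝕜 := ℝ) (ι := Fin q) (E := fun _ => ℝ)
      (fun i x => (if i = 0 then x ^ (2 * m) else 1) * Real.exp (-x ^ 2))
    have e1 : ∀ x : Fin q → ℝ, ∏ i, (if i = 0 then x i ^ (2 * m) else 1) * Real.exp (-x i ^ 2)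
        = (x 0) ^ (2 * m) * Real.exp (-∑ i, x i ^ 2) := by
      intro x
      rw [Finset.prod_mul_distrib, ← Real.exp_sum, Finset.sum_neg_distrib]
      simp
    simp only [e1] at h2
    rw [h2] at h1
    have e2 : ∀ i : Fin q, ∫ x : ℝ, (if i = 0 then x ^ (2 * m) else 1) * Real.exp (-x ^ 2) =
        if i = 0 then Real.Gamma ((m : ℝ) + 1 / 2) else Real.Gamma (1 / 2) := by
      intro i
      split_ifs
      · exact integral_even_pow_mul_exp m
      · simpa using integral_even_pow_mul_exp 0
    simp only [e2] at h1
    have e3 : (∏ i : Fin q, if i = 0 then Real.Gamma ((m : ℝ) + 1 / 2) else Real.Gamma (1 / 2))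
        = Real.Gamma ((m : ℝ) + 1 / 2) * Real.Gamma (1 / 2) ^ (q - 1) := by
      rw [← Finset.mul_prod_erase _ _ (Finset.mem_univ (0 : Fin q)), if_pos rfl]
      congr 1
      rw [Finset.prod_congr rfl (g := fun _ => Real.Gamma (1 / 2))
        fun i hi => if_neg (Finset.ne_of_mem_erase hi)]
      simp
    rw [e3] at h1
    rw [← h1]
    refine integral_congr_ae (.of_forall fun x => ?_)
    simp [EuclideanSpace.norm_sq_eq]
  set z : Vq q := ‖y‖ • EuclideanSpace.single 0 1 with hz
  have hn : ‖y‖ = ‖z‖ := by simp [hz, norm_smul]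
  set R := (ℝ ∙ (y - z))ᗮ.reflection
  have hR : R y = z := Submodule.reflection_sub hn
  have h4 := R.measurePreserving.integral_comp R.toHomeomorph.measurableEmbedding
    (fun x : Vq q => ⟪x, z⟫ ^ (2 * m) * Real.exp (-‖x‖ ^ 2))
  simp only [LinearIsometryEquiv.norm_map] at h4
  rw [← key, ← integral_const_mul]
  have h5 : ∀ x : Vq q, ⟪R x, z⟫ = ⟪x, y⟫ := by
    intro x; rw [← hR, LinearIsometryEquiv.inner_map_map]
  simp only [h5] at h4
  rw [h4]
  refine integral_congr_ae (.of_forall fun x => ?_)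
  simp [hz, inner_smul_right, EuclideanSpace.inner_single_right, mul_pow, mul_assoc]

end

section

variable {q : ℕ}

instance [NeZero q] : NeZero (sphMeasure q) := ⟨by
  have : Nontrivial (Vq q) := inferInstance
  exact Measure.toSphere_ne_zero _⟩

instance : IsFiniteMeasure (sphMeasure q) := by
  unfold sphMeasure; infer_instance

theorem integrable_sphMeasure {F : Type*} [NormedAddCommGroup F]
    {f : sphere (0 : Vq q) 1 → F} (hf : Continuous f) : Integrable f (sphMeasure q) :=
  hf.integrable_of_hasCompactSupport (HasCompactSupport.of_compactSpace f)

/-- The average of `⟨w, y⟩^{2m}` over the unit sphere of `ℝ^q`, for a unit vector `y`. -/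
def sphMoment (q m : ℕ) : ℝ :=
  Real.Gamma ((m : ℝ) + 1 / 2) * Real.Gamma ((q : ℝ) / 2) /
    (Real.Gamma (1 / 2) * Real.Gamma ((m : ℝ) + (q : ℝ) / 2))

theorem average_inner_even_pow [NeZero q] (m : ℕ) (y : Vq q) :
    ⨍ w : sphere (0 : Vq q) 1, ⟪(w : Vq q), y⟫ ^ (2 * m) ∂(sphMeasure q) =
      sphMoment q m * ‖y‖ ^ (2 * m) := by
  have hq : 0 < q := Nat.pos_of_ne_zero (NeZero.ne q)
  have hq' : (0 : ℝ) < (q : ℝ) / 2 := by positivity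
  have h0 := integral_homogeneous_mul_exp (E := Vq q) volume (fun _ => 1) 0 (by simp)
  have h0' := integral_inner_pow_mul_exp (q := q) 0 0
  have h1 := integral_homogeneous_mul_exp (E := Vq q) volume (fun x => ⟪x, y⟫ ^ (2 * m)) (2 * m)
    (fun r w => by rw [inner_smul_left]; simp [mul_pow])
  rw [integral_inner_pow_mul_exp] at h1
  simp only [mul_zero, pow_zero, one_mul, Nat.cast_zero, zero_add] at h0'
  simp only [one_mul, h0', integral_const, smul_eq_mul, mul_one, zero_add,
    finrank_euclideanSpace, Fintype.card_fin] at h0 h1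
  rw [average_eq, smul_eq_mul, sphMeasure]
  have hg1 : Real.Gamma (1 / 2) ≠ 0 := (Real.Gamma_pos_of_pos (by norm_num)).ne'
  have hgq : Real.Gamma ((q : ℝ) / 2) ≠ 0 := (Real.Gamma_pos_of_pos hq').ne'
  have hgm : Real.Gamma ((m : ℝ) + (q : ℝ) / 2) ≠ 0 :=
    (Real.Gamma_pos_of_pos (by positivity)).ne'
  have hq2 : ((2 * m + q : ℕ) : ℝ) / 2 = (m : ℝ) + (q : ℝ) / 2 := by push_cast; ring
  rw [hq2] at h1
  have hA : (volume.toSphere : Measure (sphere (0 : Vq q) 1)).real Set.univ ≠ 0 := by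
    intro h
    rw [h, zero_mul] at h0
    have := mul_ne_zero hg1 (pow_ne_zero (q - 1) hg1)
    exact this h0
  rw [inv_mul_eq_iff_eq_mul₀ hA, sphMoment]
  field_simp at h0 h1 ⊢
  linear_combination (-Real.Gamma (1/2)) * h1 +
    ‖y‖ ^ (2 * m) * Real.Gamma ((2 * (m : ℝ) + 1) / 2) * h0

theorem average_inner_odd_pow_mul [NeZero q] (m : ℕ) (y z : Vq q) :
    ⨍ w : sphere (0 : Vq q) 1, ⟪(w : Vq q), y⟫ ^ (2 * m + 1) * ⟪(w : Vq q), z⟫ ∂(sphMeasure q) =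
      sphMoment q (m + 1) * ‖y‖ ^ (2 * m) * ⟪y, z⟫ := by
  by_cases hy : y = 0
  · simp [hy]
  have hy' : ‖y‖ ^ 2 ≠ 0 := by simpa using hy
  have orth : ∀ z : Vq q, ⟪y, z⟫ = 0 →
      ⨍ w : sphere (0 : Vq q) 1, ⟪(w : Vq q), y⟫ ^ (2 * m + 1) * ⟪(w : Vq q), z⟫
        ∂(sphMeasure q) = 0 := by
    intro z hz
    have h1 := integral_homogeneous_mul_exp (E := Vq q) volume
      (fun x => ⟪x, y⟫ ^ (2 * m + 1) * ⟪x, z⟫) (2 * m + 2)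
      (fun r w => by simp only [inner_smul_left]; simp; ring)
    set R := (ℝ ∙ z)ᗮ.reflection
    have hRz : R z = -z := Submodule.reflection_orthogonalComplement_singleton_eq_neg z
    have hRy : R y = y := by
      refine Submodule.reflection_mem_subspace_eq_self ?_
      rw [Submodule.mem_orthogonal_singleton_iff_inner_left]; exact hz
    have h4 := R.measurePreserving.integral_comp R.toHomeomorph.measurableEmbedding
      (fun x : Vq q => ⟪x, y⟫ ^ (2 * m + 1) * ⟪x, z⟫ * Real.exp (-‖x‖ ^ 2))
    have h5 : ∀ x : Vq q, ⟪R x, z⟫ = -⟪x, z⟫ := by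
      intro x
      have := LinearIsometryEquiv.inner_map_map R x z
      rw [hRz, inner_neg_right] at this
      linarith
    have h6 : ∀ x : Vq q, ⟪R x, y⟫ = ⟪x, y⟫ := by
      intro x
      have := LinearIsometryEquiv.inner_map_map R x y
      rwa [hRy] at this
    simp only [LinearIsometryEquiv.norm_map, h5, h6, mul_neg, neg_mul, integral_neg] at h4
    have h7 : ∫ x : Vq q, ⟪x, y⟫ ^ (2 * m + 1) * ⟪x, z⟫ * Real.exp (-‖x‖ ^ 2) = 0 := by
      linarith
    rw [h7] at h1
    have : 0 < Real.Gamma (((2 * m + 2 + Module.finrank ℝ (Vq q) : ℕ) : ℝ) / 2) :=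
      Real.Gamma_pos_of_pos (by positivity)
    have h8 := (mul_eq_zero.1 h1.symm).resolve_right (by positivity)
    rw [average_eq, sphMeasure, h8, smul_zero]
  set t : ℝ := ⟪y, z⟫ / ‖y‖ ^ 2
  have ho := orth (z - t • y) (by
    rw [inner_sub_right, inner_smul_right, real_inner_self_eq_norm_sq,
      div_mul_cancel₀ _ hy', sub_self])
  have he := average_inner_even_pow (m + 1) y
  rw [average_eq, smul_eq_mul] at ho he ⊢
  have e1 : ∀ w : sphere (0 : Vq q) 1,
      ⟪(w : Vq q), y⟫ ^ (2 * m + 1) * ⟪(w : Vq q), z - t • y⟫ =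
      ⟪(w : Vq q), y⟫ ^ (2 * m + 1) * ⟪(w : Vq q), z⟫ - t * ⟪(w : Vq q), y⟫ ^ (2 * (m + 1)) := by
    intro w; rw [inner_sub_right, inner_smul_right]; ring
  simp only [e1] at ho
  rw [integral_sub (integrable_sphMeasure (by fun_prop)) (integrable_sphMeasure (by fun_prop)),
    integral_const_mul, mul_sub, mul_left_comm _ t, he, sub_eq_zero] at ho
  rw [ho]
  simp only [t]
  field_simp
  ring

/-- The coefficients of the generalized CK-extension. -/
def gckConst (q k : ℕ) : ℝ :=
  if k % 2 = 0 then
    Real.Gamma ((q : ℝ) / 2) /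
        (2 ^ k * ((k / 2)! : ℝ) * Real.Gamma (((k / 2 : ℕ) : ℝ) + (q : ℝ) / 2))
  else
    Real.Gamma ((q : ℝ) / 2) /
        (2 ^ k * ((k / 2)! : ℝ) * Real.Gamma (((k / 2 : ℕ) : ℝ) + (q : ℝ) / 2 + 1))

theorem gckConst_even (q m : ℕ) : gckConst q (2 * m) = Real.Gamma ((q : ℝ) / 2) /
    (2 ^ (2 * m) * (m ! : ℝ) * Real.Gamma ((m : ℝ) + (q : ℝ) / 2)) := by
  simp [gckConst]

theorem gckConst_odd (q m : ℕ) : gckConst q (2 * m + 1) = Real.Gamma ((q : ℝ) / 2) /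
    (2 ^ (2 * m + 1) * (m ! : ℝ) * Real.Gamma ((m : ℝ) + (q : ℝ) / 2 + 1)) := by
  have h1 : (2 * m + 1) % 2 = 1 := by omega
  have h2 : (2 * m + 1) / 2 = m := by omega
  simp [gckConst, h1, h2]

theorem gckConst_zero [NeZero q] : gckConst q 0 = 1 := by
  have h : 0 < (q : ℝ) / 2 := by
    have : 0 < q := Nat.pos_of_ne_zero (NeZero.ne q)
    positivity
  have := (Real.Gamma_pos_of_pos h).ne'
  simpa [this] using gckConst_even q 0

theorem gckConst_even_eq [NeZero q] (m : ℕ) :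
    gckConst q (2 * m) = (2 * m + q) * gckConst q (2 * m + 1) := by
  have h : 0 < (q : ℝ) := by
    have : 0 < q := Nat.pos_of_ne_zero (NeZero.ne q)
    positivity
  have h' : 0 < (m : ℝ) + (q : ℝ) / 2 := by positivity
  have := (Real.Gamma_pos_of_pos h').ne'
  rw [gckConst_even, gckConst_odd, Real.Gamma_add_one h'.ne', pow_succ]
  field_simp

theorem gckConst_odd_eq [NeZero q] (m : ℕ) :
    gckConst q (2 * m + 1) = (2 * m + 2) * gckConst q (2 * m + 2) := by
  have h : 0 < (q : ℝ) := by
    have : 0 < q := Nat.pos_of_ne_zero (NeZero.ne q)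
    positivity
  have h' : 0 < (m : ℝ) + (q : ℝ) / 2 + 1 := by positivity
  have := (Real.Gamma_pos_of_pos h').ne'
  have e := gckConst_even q (m + 1)
  rw [show 2 * (m + 1) = 2 * m + 2 by ring] at e
  rw [e, gckConst_odd, Nat.factorial_succ]
  push_cast
  rw [show (m : ℝ) + 1 + (q : ℝ) / 2 = (m : ℝ) + (q : ℝ) / 2 + 1 by ring]
  field_simp
  ring

theorem Gamma_nat_add_half_eq (m : ℕ) :
    ((2 * m)! : ℝ) * Real.Gamma (1 / 2) = 2 ^ (2 * m) * (m ! : ℝ) * Real.Gamma ((m : ℝ) + 1 / 2) := by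
  induction m with
  | zero => simp
  | succ m ih =>
    have h' : 0 < (m : ℝ) + 1 / 2 := by positivity
    rw [show 2 * (m + 1) = 2 * m + 1 + 1 by ring, Nat.factorial_succ, Nat.factorial_succ,
      Nat.factorial_succ]
    push_cast
    rw [show (m : ℝ) + 1 + 1 / 2 = (m : ℝ) + 1 / 2 + 1 by ring, Real.Gamma_add_one h'.ne']
    linear_combination (2 * (m : ℝ) + 1 + 1) * (2 * m + 1) * ih

theorem factorial_mul_gckConst_even [NeZero q] (m : ℕ) :
    ((2 * m)! : ℝ) * gckConst q (2 * m) = sphMoment q m := by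
  have h : 0 < (q : ℝ) := by
    have : 0 < q := Nat.pos_of_ne_zero (NeZero.ne q)
    positivity
  have h' : 0 < (m : ℝ) + (q : ℝ) / 2 := by positivity
  have h1 := (Real.Gamma_pos_of_pos h').ne'
  have hg1 : Real.Gamma (1 / 2) ≠ 0 := (Real.Gamma_pos_of_pos (by norm_num)).ne'
  rw [gckConst_even, sphMoment, ← mul_div_assoc, div_eq_div_iff (by positivity) (by positivity)]
  linear_combination Real.Gamma ((q : ℝ) / 2) * Real.Gamma ((m : ℝ) + (q : ℝ) / 2) *
    Gamma_nat_add_half_eq m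

theorem factorial_mul_gckConst_odd [NeZero q] (m : ℕ) :
    ((2 * m + 1)! : ℝ) * gckConst q (2 * m + 1) = sphMoment q (m + 1) := by
  have h := gckConst_odd_eq (q := q) m
  have h2 := factorial_mul_gckConst_even (q := q) (m + 1)
  rw [show 2 * (m + 1) = 2 * m + 1 + 1 by ring, Nat.factorial_succ] at h2
  rw [← h2, h]
  push_cast
  ring

theorem gckConst_nonneg (q k : ℕ) : 0 ≤ gckConst q k := by
  have h1 : ∀ x : ℝ, 0 ≤ x → 0 ≤ Real.Gamma x := fun x hx => Real.Gamma_nonneg_of_nonneg hx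
  unfold gckConst
  split_ifs <;> exact div_nonneg (h1 _ (by positivity))
    (mul_nonneg (by positivity) (h1 _ (by positivity)))

theorem gckConst_le [NeZero q] (k : ℕ) : gckConst q k ≤ (k ! : ℝ)⁻¹ := by
  have hq : (1 : ℝ) ≤ q := by exact_mod_cast Nat.pos_of_ne_zero (NeZero.ne q)
  have step : ∀ k : ℕ, ((k : ℝ) + 1) * gckConst q (k + 1) ≤ gckConst q k := by
    intro k
    obtain ⟨m, rfl | rfl⟩ := Nat.even_or_odd' k
    · rw [gckConst_even_eq]
      have := gckConst_nonneg q (2 * m + 1)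
      gcongr
      push_cast; linarith
    · rw [gckConst_odd_eq]
      push_cast
      exact le_of_eq (by ring)
  induction k with
  | zero => simp [gckConst_zero]
  | succ k ih =>
    have h := (step k).trans ih
    rw [Nat.factorial_succ, Nat.cast_mul, mul_inv]
    rw [mul_comm, ← le_div_iff₀ (by positivity)] at h
    push_cast
    rw [div_eq_mul_inv, mul_comm] at h
    exact h

end

/-- Local Cauchy estimates for a real analytic function. -/
theorem exists_norm_iteratedFDeriv_le {E F : Type*} [NormedAddCommGroup E] [NormedSpace ℝ E]
    [NormedAddCommGroup F] [NormedSpace ℝ F] [CompleteSpace F] {f : E → F} {x₀ : E}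
    (hf : AnalyticAt ℝ f x₀) :
    ∃ r > 0, ∃ C ≥ 0, ∃ M ≥ 0, ∀ x ∈ ball x₀ r, ∀ n : ℕ,
      ‖iteratedFDeriv ℝ n f x‖ ≤ C * M ^ n * (n ! : ℝ) := by
  obtain ⟨P, R, hP⟩ := hf
  obtain ⟨s, hs0, hsR⟩ := ENNReal.lt_iff_exists_nnreal_btwn.1 hP.r_pos
  have hs0' : (0 : NNReal) < s := by exact_mod_cast hs0
  set t : NNReal := s / 2 with ht
  have ht0 : 0 < t := by positivity
  have htt : (t : ENNReal) + t < P.radius := by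
    rw [← ENNReal.coe_add, ht, add_halves]; exact hsR.trans_le hP.r_le
  have hsum := NNReal.summable_sigma.1 (P.changeOriginSeries_summable_aux₁ htt)
  set B : ℕ → NNReal := fun k =>
    ∑' y : Σ l : ℕ, { s : Finset (Fin (k + l)) // s.card = l },
      ‖P (k + y.1)‖₊ * t ^ y.1 * t ^ k with hB
  obtain ⟨S, hBle⟩ : ∃ S : NNReal, ∀ k, B k ≤ S := ⟨∑' k, B k, fun k => hsum.2.le_tsum' k⟩
  refine ⟨t, ht0, S, NNReal.coe_nonneg _, (t : ℝ)⁻¹, by positivity, fun x hx n => ?_⟩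
  have hxt : ‖x - x₀‖₊ ≤ t := by
    have : ‖x - x₀‖ < t := by simpa [dist_eq_norm] using hx
    exact this.le
  have hxR : ((‖x - x₀‖₊ : NNReal) : ENNReal) < R := by
    refine lt_of_le_of_lt ?_ hsR
    refine ENNReal.coe_le_coe.2 (hxt.trans ?_)
    rw [ht]; exact half_le_self (zero_le)
  have hc := hP.changeOrigin hxR
  rw [add_sub_cancel] at hc
  have hb : ‖P.changeOrigin (x - x₀) n‖₊ * t ^ n ≤ S := by
    refine le_trans ?_ (hBle n)
    refine le_trans (mul_le_mul_left (P.nnnorm_changeOrigin_le n (hxR.trans_le hP.r_le)) _) ?_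
    rw [hB, ← NNReal.tsum_mul_right]
    have h2 : Summable fun y : Σ l : ℕ, { s : Finset (Fin (n + l)) // s.card = l } =>
        ‖P (n + y.1)‖₊ * t ^ y.1 * t ^ n := hsum.1 n
    refine Summable.tsum_le_tsum (fun y => ?_) (NNReal.summable_of_le (fun y => ?_) h2) h2 <;>
    gcongr
  have hb' : ‖P.changeOrigin (x - x₀) n‖ ≤ (S : ℝ) * (t : ℝ)⁻¹ ^ n := by
    rw [inv_pow, ← div_eq_mul_inv, le_div_iff₀ (by positivity)]
    exact_mod_cast hb
  refine ContinuousMultilinearMap.opNorm_le_bound (by positivity) fun v => ?_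
  rw [hc.iteratedFDeriv_eq_sum_of_completeSpace]
  calc _ ≤ ∑ σ : Equiv.Perm (Fin n), ‖P.changeOrigin (x - x₀) n (fun i => v (σ i))‖ :=
        norm_sum_le _ _
    _ ≤ ∑ σ : Equiv.Perm (Fin n), (S : ℝ) * (t : ℝ)⁻¹ ^ n * ∏ i, ‖v i‖ := by
        refine Finset.sum_le_sum fun σ _ => (ContinuousMultilinearMap.le_opNorm _ _).trans ?_
        rw [Equiv.prod_comp σ (fun i => ‖v i‖)]
        gcongr
    _ = _ := by
        rw [Finset.sum_const, Finset.card_univ, Fintype.card_perm, Fintype.card_fin, nsmul_eq_mul]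
        ring

section Algebra

variable {p q : ℕ} {A : Type*} [NormedRing A] [NormedAlgebra ℝ A] (ξ : A ≃ₐ[ℝ] Cl (p + q))

theorem gen_mul_add (i j : Fin (p + q)) :
    gen p q ξ i * gen p q ξ j + gen p q ξ j * gen p q ξ i = if i = j then -2 else 0 := by
  have h := CliffordAlgebra.ι_mul_ι_add_swap (Q := Qe (p + q)) (Pi.single i (1 : ℝ))
    (Pi.single j (1 : ℝ))
  unfold gen e
  rw [← map_mul ξ.symm, ← map_mul ξ.symm, ← map_add ξ.symm, h, AlgEquiv.commutes]
  have : QuadraticMap.polar (Qe (p + q)) (Pi.single i (1 : ℝ)) (Pi.single j (1 : ℝ)) =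
      if i = j then -2 else 0 := by
    simp only [QuadraticMap.polar, Qe, QuadraticMap.weightedSumSquares_apply, smul_eq_mul,
      ← Finset.sum_sub_distrib, Pi.add_apply]
    have e1 : ∀ k : Fin (p + q), -1 * (((Pi.single i (1 : ℝ) : Fin (p + q) → ℝ) k +
          (Pi.single j (1 : ℝ) : Fin (p + q) → ℝ) k) *
        ((Pi.single i (1 : ℝ) : Fin (p + q) → ℝ) k + (Pi.single j (1 : ℝ) : Fin (p + q) → ℝ) k)) -
        -1 * ((Pi.single i (1 : ℝ) : Fin (p + q) → ℝ) k *
          (Pi.single i (1 : ℝ) : Fin (p + q) → ℝ) k) -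
        -1 * ((Pi.single j (1 : ℝ) : Fin (p + q) → ℝ) k *
          (Pi.single j (1 : ℝ) : Fin (p + q) → ℝ) k) =
        if k = i then (if i = j then -2 else 0) else 0 := by
      intro k
      simp only [Pi.single_apply]
      split_ifs <;> simp_all
      norm_num
    simp only [e1, Finset.sum_ite_eq', Finset.mem_univ, if_true]
  rw [this]
  split_ifs
  · rw [map_neg]; exact congrArg Neg.neg (map_ofNat (algebraMap ℝ A) 2)
  · exact map_zero _

theorem eQ_mul_add (i j : Fin q) :
    eQ p q ξ i * eQ p q ξ j + eQ p q ξ j * eQ p q ξ i = if i = j then -2 else 0 := by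
  unfold eQ
  rw [gen_mul_add]
  simp [Fin.ext_iff]

/-- The Clifford conjugates `1, -e_1, …, -e_p` of the paravector basis. -/
def εbar (i : Fin (p + 1)) : A := if i = 0 then 1 else -εp p q ξ i

theorem εp_zero : εp p q ξ 0 = 1 := by simp [εp]

theorem εp_succ (i : Fin p) : εp p q ξ i.succ = gen p q ξ (Fin.castAdd q i) := by
  simp only [εp, Fin.val_succ, Nat.add_one_ne_zero, dite_false, Nat.add_sub_cancel]
  rfl

theorem εbar_mul_add (i j : Fin (p + 1)) :
    εbar ξ i * εp p q ξ j + εbar ξ j * εp p q ξ i = if i = j then 2 else 0 := by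
  refine Fin.cases ?_ (fun i => ?_) i <;> refine Fin.cases ?_ (fun j => ?_) j
  · simp [εbar, εp_zero]; norm_num
  · simp [εbar, εp_zero, (Fin.succ_ne_zero j).symm]
  · simp [εbar, εp_zero]
  · have := gen_mul_add ξ (Fin.castAdd q i) (Fin.castAdd q j)
    simp only [εbar, Fin.succ_ne_zero, if_false, εp_succ, neg_mul, Fin.succ_inj]
    rw [← neg_add, this]
    simp only [Fin.castAdd_inj]
    split_ifs <;> simp

theorem εp_mul_eQ (i : Fin (p + 1)) (j : Fin q) :
    εp p q ξ i * eQ p q ξ j = eQ p q ξ j * εbar ξ i := by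
  refine Fin.cases ?_ (fun i => ?_) i
  · simp [εbar, εp_zero]
  · have := gen_mul_add ξ (Fin.castAdd q i) (Fin.natAdd p j)
    rw [if_neg (by simp [Fin.ext_iff]; have := i.2; omega)] at this
    simp only [εbar, Fin.succ_ne_zero, if_false, εp_succ, mul_neg]
    exact eq_neg_of_add_eq_zero_left this

theorem εp_mul_ωCl (i : Fin (p + 1)) (v : Vq q) :
    εp p q ξ i * ωCl p q ξ v = ωCl p q ξ v * εbar ξ i := by
  simp only [ωCl, Finset.mul_sum, Finset.sum_mul, mul_smul_comm, smul_mul_assoc, εp_mul_eQ]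

theorem ωCl_mul_add (v w : Vq q) :
    ωCl p q ξ v * ωCl p q ξ w + ωCl p q ξ w * ωCl p q ξ v = (-2 * ⟪v, w⟫) • (1 : A) := by
  have h1 : ωCl p q ξ v * ωCl p q ξ w =
      ∑ i, ∑ j, (v i * w j) • (eQ p q ξ i * eQ p q ξ j) := by
    simp only [ωCl, Finset.sum_mul, Finset.mul_sum, smul_mul_assoc, mul_smul_comm,
      Finset.smul_sum, smul_smul]
    rw [Finset.sum_comm]
    refine Finset.sum_congr rfl fun i _ => Finset.sum_congr rfl fun j _ => ?_
    ring_nf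
  have h2 : ωCl p q ξ w * ωCl p q ξ v =
      ∑ i, ∑ j, (v i * w j) • (eQ p q ξ j * eQ p q ξ i) := by
    simp only [ωCl, Finset.sum_mul, Finset.mul_sum, smul_mul_assoc, mul_smul_comm,
      Finset.smul_sum, smul_smul]
  rw [h1, h2]
  simp only [← Finset.sum_add_distrib, ← smul_add, eQ_mul_add]
  have e2 : (-2 : A) = (-2 : ℝ) • (1 : A) := by
    rw [neg_smul, ofNat_smul_eq_nsmul, nsmul_eq_mul]; simp
  simp only [e2, smul_ite, smul_zero, Finset.sum_ite_eq, Finset.mem_univ, if_true, smul_smul,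
    ← Finset.sum_smul, PiLp.inner_apply, Real.inner_apply, Finset.mul_sum]
  congr 1
  exact Finset.sum_congr rfl fun i _ => by simp; ring

theorem ωCl_sq (v : Vq q) : ωCl p q ξ v * ωCl p q ξ v = (-‖v‖ ^ 2) • (1 : A) := by
  have h := ωCl_mul_add ξ v v
  rw [← two_smul ℝ, real_inner_self_eq_norm_sq, neg_mul, ← mul_neg, mul_smul] at h
  exact smul_right_injective A (two_ne_zero (α := ℝ)) h

theorem ωCl_pow_even (v : Vq q) (m : ℕ) :
    ωCl p q ξ v ^ (2 * m) = ((-‖v‖ ^ 2) ^ m) • (1 : A) := by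
  rw [pow_mul, pow_two, ωCl_sq, smul_pow, one_pow]

theorem ωCl_pow_odd (v : Vq q) (m : ℕ) :
    ωCl p q ξ v ^ (2 * m + 1) = ((-‖v‖ ^ 2) ^ m) • ωCl p q ξ v := by
  rw [pow_succ, ωCl_pow_even, smul_mul_assoc, one_mul]

theorem ωCl_smul (r : ℝ) (v : Vq q) : ωCl p q ξ (r • v) = r • ωCl p q ξ v := by
  simp [ωCl, Finset.smul_sum, smul_smul]

theorem sum_eQ_mul_self : ∑ j, eQ p q ξ j * eQ p q ξ j = -(q : A) := by
  have : ∀ j : Fin q, eQ p q ξ j * eQ p q ξ j = -1 := by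
    intro j
    have h := eQ_mul_add ξ j j
    rw [if_pos rfl, ← two_smul ℝ] at h
    have e2 : (-2 : A) = (2 : ℝ) • (-1 : A) := by
      rw [ofNat_smul_eq_nsmul, nsmul_eq_mul]; simp
    rw [e2] at h
    exact smul_right_injective A (two_ne_zero (α := ℝ)) h
  simp [this]

/-- The operator `∑ a_i ∂_{x_i}`. -/
def dirOp (a : Fin (p + 1) → A) (g : Vp p → A) : Vp p → A :=
  fun x => ∑ i, a i * pdP p i g x

/-- The functions `Δ^k f₀` and `D Δ^k f₀`. -/
def dIter (f : Vp p → A) (k : ℕ) : Vp p → A :=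
  if k % 2 = 0 then (LapP p)^[k / 2] f else DPfun p q ξ ((LapP p)^[k / 2] f)

theorem dIter_even (f : Vp p → A) (m : ℕ) : dIter ξ f (2 * m) = (LapP p)^[m] f := by
  simp [dIter]

theorem dIter_odd (f : Vp p → A) (m : ℕ) :
    dIter ξ f (2 * m + 1) = DPfun p q ξ ((LapP p)^[m] f) := by
  have h1 : (2 * m + 1) % 2 = 1 := by omega
  have h2 : (2 * m + 1) / 2 = m := by omega
  simp [dIter, h1, h2]

theorem gckTerm_eq (f : Vp p → A) (k : ℕ) (z : V p q) :
    gckTerm p q ξ f k z = gckConst q k • (ωCl p q ξ z.2 ^ k * dIter ξ f k z.1) := by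
  unfold gckTerm gckCoeff gckConst dIter
  split_ifs <;> rw [mul_smul_comm]

variable [CompleteSpace A]

theorem analyticAt_pdP {g : Vp p → A} {x : Vp p} (hg : AnalyticAt ℝ g x) (i : Fin (p + 1)) :
    AnalyticAt ℝ (pdP p i g) x :=
  ((ContinuousLinearMap.apply ℝ A (Pi.single i (1 : ℝ) : Vp p)).analyticAt _).comp hg.fderiv

theorem analyticAt_dirOp (a : Fin (p + 1) → A) {g : Vp p → A} {x : Vp p}
    (hg : AnalyticAt ℝ g x) : AnalyticAt ℝ (dirOp a g) x :=
  Finset.analyticAt_fun_sum _ fun i _ => analyticAt_const.mul (analyticAt_pdP hg i)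

theorem analyticAt_LapP {g : Vp p → A} {x : Vp p} (hg : AnalyticAt ℝ g x) :
    AnalyticAt ℝ (LapP p g) x :=
  Finset.analyticAt_fun_sum _ fun i _ => analyticAt_pdP (analyticAt_pdP hg i) i

theorem analyticAt_LapP_iterate {g : Vp p → A} {x : Vp p} (hg : AnalyticAt ℝ g x) (m : ℕ) :
    AnalyticAt ℝ ((LapP p)^[m] g) x := by
  induction m with
  | zero => exact hg
  | succ m ih => rw [Function.iterate_succ_apply']; exact analyticAt_LapP ih

theorem analyticAt_dIter {g : Vp p → A} {x : Vp p} (hg : AnalyticAt ℝ g x) (k : ℕ) :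
    AnalyticAt ℝ (dIter ξ g k) x := by
  unfold dIter
  split_ifs
  · exact analyticAt_LapP_iterate hg _
  · exact analyticAt_dirOp _ (analyticAt_LapP_iterate hg _)

theorem pdP_comm {g : Vp p → A} {x : Vp p} (hg : AnalyticAt ℝ g x) (i j : Fin (p + 1)) :
    pdP p i (pdP p j g) x = pdP p j (pdP p i g) x := by
  have hd : DifferentiableAt ℝ (fderiv ℝ g) x := hg.fderiv.differentiableAt
  have key : ∀ i j, pdP p i (pdP p j g) x =
      fderiv ℝ (fderiv ℝ g) x (Pi.single i 1) (Pi.single j 1) := by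
    intro i j
    have h := (hd.hasFDerivAt.clm_apply
      (hasFDerivAt_const (Pi.single j (1 : ℝ) : Vp p) x)).fderiv
    show fderiv ℝ (fun y => fderiv ℝ g y (Pi.single j 1)) x (Pi.single i 1) = _
    rw [h]
    simp
  rw [key, key]
  have hs : IsSymmSndFDerivAt ℝ g x :=
    hg.contDiffAt.isSymmSndFDerivAt (n := ⊤) (by simp)
  exact hs _ _

theorem dirOp_εbar_DPfun {g : Vp p → A} {x : Vp p} (hg : AnalyticAt ℝ g x) :
    dirOp (εbar ξ) (DPfun p q ξ g) x = LapP p g x := by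
  have h1 : ∀ i, pdP p i (DPfun p q ξ g) x = ∑ j, εp p q ξ j * pdP p i (pdP p j g) x := by
    intro i
    have : HasFDerivAt (DPfun p q ξ g)
        (∑ j, (εp p q ξ j) • fderiv ℝ (pdP p j g) x) x := by
      refine HasFDerivAt.fun_sum fun j _ => ?_
      exact (analyticAt_pdP hg j).differentiableAt.hasFDerivAt.const_mul _
    rw [pdP, this.fderiv]
    simp [pdP]
  simp only [dirOp, h1, Finset.mul_sum, ← mul_assoc]
  set T : A := ∑ i, ∑ j, εbar ξ i * εp p q ξ j * pdP p i (pdP p j g) x with hT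
  have hT' : T = ∑ i, ∑ j, εbar ξ j * εp p q ξ i * pdP p i (pdP p j g) x := by
    rw [hT, Finset.sum_comm]
    refine Finset.sum_congr rfl fun i _ => Finset.sum_congr rfl fun j _ => ?_
    rw [pdP_comm hg]
  have h2 : (2 : ℝ) • T = (2 : ℝ) • LapP p g x := by
    rw [two_smul]
    nth_rewrite 2 [hT']
    rw [hT]
    simp only [← Finset.sum_add_distrib, ← add_mul, εbar_mul_add, ite_mul, zero_mul,
      Finset.sum_ite_eq, Finset.mem_univ, if_true]
    rw [LapP, Finset.smul_sum]
    refine Finset.sum_congr rfl fun i _ => ?_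
    rw [two_smul, two_mul]
  exact smul_right_injective A (two_ne_zero (α := ℝ)) h2

theorem dIter_succ {f : Vp p → A} {x : Vp p} (hf : AnalyticAt ℝ f x) (k : ℕ) :
    dIter ξ f (k + 1) x = dirOp (if k % 2 = 0 then εp p q ξ else εbar ξ) (dIter ξ f k) x := by
  obtain ⟨m, rfl | rfl⟩ := Nat.even_or_odd' k
  · rw [dIter_odd, dIter_even]; simp [dirOp, DPfun]
  · rw [show 2 * m + 1 + 1 = 2 * (m + 1) by ring, dIter_even, dIter_odd, if_neg (by omega),
      dirOp_εbar_DPfun ξ (analyticAt_LapP_iterate hf m), Function.iterate_succ_apply']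

theorem sum_εp_mul {f : Vp p → A} {x : Vp p} (hf : AnalyticAt ℝ f x) (v : Vq q) (k : ℕ) :
    ∑ i, εp p q ξ i * (ωCl p q ξ v ^ k * pdP p i (dIter ξ f k) x) =
      ωCl p q ξ v ^ k * dIter ξ f (k + 1) x := by
  rw [dIter_succ ξ hf, dirOp, Finset.mul_sum]
  refine Finset.sum_congr rfl fun i _ => ?_
  obtain ⟨m, rfl | rfl⟩ := Nat.even_or_odd' k
  · simp [ωCl_pow_even]
  · rw [if_neg (by omega), ωCl_pow_odd]
    simp only [smul_mul_assoc, mul_smul_comm]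
    rw [← mul_assoc, εp_mul_ωCl, mul_assoc]

theorem uDpow_eq {f : Vp p → A} (v : Vq q) (k : ℕ) :
    ∀ x, AnalyticAt ℝ f x →
      uDpow p q ξ (ωCl p q ξ v) k f x = ωCl p q ξ v ^ k * dIter ξ f k x := by
  induction k with
  | zero => intro x _; simp [uDpow, dIter]
  | succ k ih =>
    intro x hf
    have he : uDpow p q ξ (ωCl p q ξ v) k f =ᶠ[𝓝 x] fun y => ωCl p q ξ v ^ k * dIter ξ f k y :=
      hf.eventually_analyticAt.mono ih
    have h1 : ∀ i, pdP p i (uDpow p q ξ (ωCl p q ξ v) k f) x =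
        ωCl p q ξ v ^ k * pdP p i (dIter ξ f k) x := by
      intro i
      have := (analyticAt_dIter ξ hf k).differentiableAt.hasFDerivAt.const_mul (ωCl p q ξ v ^ k)
      rw [pdP, he.fderiv_eq, this.fderiv]
      simp [pdP]
    simp only [uDpow, DPfun, h1]
    rw [sum_εp_mul ξ hf, pow_succ', mul_assoc]

theorem ckTerm_eq {f : Vp p → A} {z : V p q} (hf : AnalyticAt ℝ f z.1) (k : ℕ) :
    ckTerm p q ξ f k z = (k ! : ℝ)⁻¹ • (ωCl p q ξ z.2 ^ k * dIter ξ f k z.1) := by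
  rw [ckTerm, uDpow_eq ξ _ _ _ hf]

theorem ckDirTerm_eq {f : Vp p → A} {z : V p q} (hf : AnalyticAt ℝ f z.1) (w : Vq q) (k : ℕ) :
    ckDirTerm p q ξ w f k z = ckTerm p q ξ f k (z.1, ⟪w, z.2⟫ • w) := by
  rw [ckTerm_eq ξ (by exact hf), ckDirTerm, uDpow_eq ξ _ _ _ hf]
  simp only [ωCl_smul, smul_pow, smul_mul_assoc, smul_smul]
  rw [div_eq_inv_mul]

end Algebra

section Bounds

variable {p q : ℕ} {A : Type*} [NormedRing A] [NormedAlgebra ℝ A] (ξ : A ≃ₐ[ℝ] Cl (p + q))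

/-- The action of `∑ a_i ∂_{x_i}` on differentials. -/
def dirCLM (a : Fin (p + 1) → A) : (Vp p →L[ℝ] A) →L[ℝ] A :=
  ∑ i, (ContinuousLinearMap.mul ℝ A (a i)).comp
    (ContinuousLinearMap.apply ℝ A (Pi.single i (1 : ℝ) : Vp p))

theorem dirOp_eq_dirCLM (a : Fin (p + 1) → A) (g : Vp p → A) :
    dirOp a g = dirCLM a ∘ fderiv ℝ g := by
  ext x
  simp [dirOp, dirCLM, pdP]

theorem exists_norm_iteratedFDeriv_dIter_le [CompleteSpace A] :
    ∃ K ≥ 0, ∀ (f : Vp p → A) (x : Vp p), AnalyticAt ℝ f x → ∀ k m : ℕ,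
      ‖iteratedFDeriv ℝ m (dIter ξ f k) x‖ ≤ K ^ k * ‖iteratedFDeriv ℝ (m + k) f x‖ := by
  set K : ℝ := max ‖dirCLM (εp p q ξ)‖ ‖dirCLM (εbar ξ)‖
  have hK : 0 ≤ K := le_max_of_le_left (by positivity)
  refine ⟨K, hK, fun f x hf k => ?_⟩
  induction k with
  | zero => intro m; simp [dIter]
  | succ k ih =>
    intro m
    set a : Fin (p + 1) → A := if k % 2 = 0 then εp p q ξ else εbar ξ with ha
    have haK : ‖dirCLM a‖ ≤ K := by
      rw [ha]; split_ifs
      · exact le_max_left _ _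
      · exact le_max_right _ _
    have he : dIter ξ f (k + 1) =ᶠ[𝓝 x] dirCLM a ∘ fderiv ℝ (dIter ξ f k) := by
      rw [← dirOp_eq_dirCLM]
      exact hf.eventually_analyticAt.mono fun y hy => dIter_succ ξ hy k
    rw [(he.iteratedFDeriv ℝ m).self_of_nhds]
    have hG : ContDiffAt ℝ m (fderiv ℝ (dIter ξ f k)) x :=
      (analyticAt_dIter ξ hf k).fderiv.contDiffAt
    calc _ ≤ ‖dirCLM a‖ * ‖iteratedFDeriv ℝ m (fderiv ℝ (dIter ξ f k)) x‖ :=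
          (dirCLM a).norm_iteratedFDeriv_comp_left hG le_rfl
      _ = ‖dirCLM a‖ * ‖iteratedFDeriv ℝ (m + 1) (dIter ξ f k) x‖ := by
          rw [norm_iteratedFDeriv_fderiv]
      _ ≤ K * (K ^ k * ‖iteratedFDeriv ℝ (m + 1 + k) f x‖) := by
          gcongr; exact ih _
      _ = _ := by rw [pow_succ', mul_assoc, add_right_comm, add_assoc m k 1]

/-- `ωCl` as a continuous linear map. -/
def ωCLM : Vq q →L[ℝ] A :=
  ∑ j, (EuclideanSpace.proj j : Vq q →L[ℝ] ℝ).smulRight (eQ p q ξ j)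

theorem ωCLM_apply (v : Vq q) : ωCLM ξ v = ωCl p q ξ v := by
  simp [ωCLM, ωCl]

theorem hasFDerivAt_ωCl (v : Vq q) : HasFDerivAt (ωCl p q ξ) (ωCLM ξ) v := by
  have := (ωCLM ξ).hasFDerivAt (x := v)
  rwa [show ⇑(ωCLM ξ) = ωCl p q ξ from funext (ωCLM_apply ξ)] at this

theorem analyticAt_ωCl (v : Vq q) : AnalyticAt ℝ (ωCl p q ξ) v := by
  have := (ωCLM ξ).analyticAt v
  rwa [show ⇑(ωCLM ξ) = ωCl p q ξ from funext (ωCLM_apply ξ)] at this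

/-- A bound for the norm of `ωCl`. -/
def ωBound : ℝ := ‖ωCLM ξ‖ + 1

theorem ωBound_pos : 0 < ωBound ξ := by unfold ωBound; positivity

theorem norm_ωCl_le (v : Vq q) : ‖ωCl p q ξ v‖ ≤ ωBound ξ * ‖v‖ := by
  rw [← ωCLM_apply]
  refine ((ωCLM ξ).le_opNorm v).trans ?_
  unfold ωBound
  gcongr
  linarith

theorem norm_ωCl_pow_le {r : ℝ} {v : Vq q} (hv : ‖v‖ ≤ r) (k : ℕ) :
    ‖ωCl p q ξ v ^ k‖ ≤ (1 + ‖(1 : A)‖) * (ωBound ξ * r) ^ k := by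
  have h0 := ωBound_pos ξ
  have h1 : ‖ωCl p q ξ v‖ ≤ ωBound ξ * r := (norm_ωCl_le ξ v).trans (by gcongr)
  have hr : 0 ≤ r := (norm_nonneg v).trans hv
  induction k with
  | zero => simp
  | succ k ih =>
    rw [pow_succ, pow_succ, ← mul_assoc]
    exact (norm_mul_le _ _).trans (mul_le_mul ih h1 (norm_nonneg _) (by positivity))

theorem norm_fderiv_ωCl_pow_le {r : ℝ} (hr : 0 < r) {v : Vq q} (hv : ‖v‖ ≤ r) (k : ℕ) :
    ‖fderiv ℝ (fun y => ωCl p q ξ y ^ k) v‖ ≤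
      (1 + ‖(1 : A)‖) / r * k * (ωBound ξ * r) ^ k := by
  have h0 := ωBound_pos ξ
  have h1 : ‖ωCl p q ξ v‖ ≤ ωBound ξ * r := (norm_ωCl_le ξ v).trans (by gcongr)
  induction k with
  | zero => simp
  | succ k ih =>
    have hd : HasFDerivAt (fun y => ωCl p q ξ y ^ k) (fderiv ℝ (fun y => ωCl p q ξ y ^ k) v) v :=
      ((analyticAt_ωCl ξ v).pow k).differentiableAt.hasFDerivAt
    have h := (hasFDerivAt_ωCl ξ v).mul' hd
    simp only [pow_succ']
    have h' : HasFDerivAt (fun y => ωCl p q ξ y * ωCl p q ξ y ^ k) _ v := h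
    rw [h'.fderiv]
    refine ContinuousLinearMap.opNorm_le_bound _ (by positivity) fun w => ?_
    have hw := norm_ωCl_le ξ w
    have hk := norm_ωCl_pow_le ξ hv k
    have hD := ContinuousLinearMap.le_opNorm (fderiv ℝ (fun y => ωCl p q ξ y ^ k) v) w
    simp only [add_apply, smul_apply, smul_eq_mul,
      MulOpposite.smul_eq_mul_unop, MulOpposite.unop_op, ωCLM_apply]
    calc _ ≤ ‖ωCl p q ξ v‖ * (‖fderiv ℝ (fun y => ωCl p q ξ y ^ k) v‖ * ‖w‖) +
          ‖ωCl p q ξ w‖ * ‖ωCl p q ξ v ^ k‖ := by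
          refine (norm_add_le _ _).trans (add_le_add ((norm_mul_le _ _).trans ?_) (norm_mul_le _ _))
          gcongr
      _ ≤ (ωBound ξ * r) * (((1 + ‖(1 : A)‖) / r * k * (ωBound ξ * r) ^ k) * ‖w‖) +
          (ωBound ξ * ‖w‖) * ((1 + ‖(1 : A)‖) * (ωBound ξ * r) ^ k) := by
          gcongr
      _ = _ := by
          push_cast
          field_simp

/-- The terms `c_k 𝐱_q^k (Δ^{k/2} or D Δ^{(k-1)/2}) f₀` of a generalized CK-type series. -/
def serTerm (c : ℕ → ℝ) (f : Vp p → A) (k : ℕ) (z : V p q) : A :=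
  c k • (ωCl p q ξ z.2 ^ k * dIter ξ f k z.1)

variable [CompleteSpace A]

theorem analyticAt_serTerm (c : ℕ → ℝ) {f : Vp p → A} {z : V p q} (hf : AnalyticAt ℝ f z.1)
    (k : ℕ) : AnalyticAt ℝ (serTerm ξ c f k) z := by
  have h1 : AnalyticAt ℝ (fun z : V p q => ωCl p q ξ z.2) z :=
    (analyticAt_ωCl ξ z.2).fun_comp analyticAt_snd
  have h2 : AnalyticAt ℝ (fun z : V p q => dIter ξ f k z.1) z :=
    (analyticAt_dIter ξ hf k).fun_comp analyticAt_fst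
  exact AnalyticAt.smul (𝕜 := ℝ) (A := ℝ) analyticAt_const ((h1.pow k).mul h2)

theorem fderiv_serTerm_apply (c : ℕ → ℝ) {f : Vp p → A} {z : V p q} (hf : AnalyticAt ℝ f z.1)
    (k : ℕ) (w : V p q) :
    fderiv ℝ (serTerm ξ c f k) z w = c k • (ωCl p q ξ z.2 ^ k * fderiv ℝ (dIter ξ f k) z.1 w.1 +
      fderiv ℝ (fun y => ωCl p q ξ y ^ k) z.2 w.2 * dIter ξ f k z.1) := by
  have h1 : HasFDerivAt (fun y => ωCl p q ξ y ^ k) (fderiv ℝ (fun y => ωCl p q ξ y ^ k) z.2) z.2 :=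
    ((analyticAt_ωCl ξ z.2).pow k).differentiableAt.hasFDerivAt
  have h2 := (analyticAt_dIter ξ hf k).differentiableAt.hasFDerivAt
  have h := ((h1.comp z hasFDerivAt_snd).mul' (h2.comp z hasFDerivAt_fst)).const_smul (c k)
  have h' : HasFDerivAt (serTerm ξ c f k) _ z := h
  rw [h'.fderiv]
  simp

theorem exists_bound_serTerm {f : Vp p → A} {x₀ : Vp p} (hf : AnalyticAt ℝ f x₀) :
    ∃ r > 0, ∃ u : ℕ → ℝ, Summable u ∧ ∀ z ∈ ball x₀ r ×ˢ ball (0 : Vq q) r, AnalyticAt ℝ f z.1 ∧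
      ∀ c : ℕ → ℝ, ∀ k, |c k| ≤ (k ! : ℝ)⁻¹ →
        ‖serTerm ξ c f k z‖ ≤ u k ∧ ‖fderiv ℝ (serTerm ξ c f k) z‖ ≤ u k := by
  obtain ⟨r₁, hr₁, h₁⟩ := Metric.eventually_nhds_iff_ball.1 hf.eventually_analyticAt
  obtain ⟨r₂, hr₂, C, hC, M, hM, h₂⟩ := exists_norm_iteratedFDeriv_le hf
  obtain ⟨K, hK, hKb⟩ := exists_norm_iteratedFDeriv_dIter_le ξ
  have hW := ωBound_pos ξ
  set W := ωBound ξ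
  set N : ℝ := 1 + ‖(1 : A)‖ with hN
  have hN0 : 0 ≤ N := by positivity
  set r := min (min r₁ r₂) (1 / (2 * (W * (K * M) + 1))) with hr
  have hr0 : 0 < r := by positivity
  have hWr : W * r * (K * M) ≤ 1 / 2 := by
    have h : r ≤ 1 / (2 * (W * (K * M) + 1)) := min_le_right _ _
    rw [le_div_iff₀ (by positivity)] at h
    nlinarith
  refine ⟨r, hr0, fun k => N * C * (1 + M + 1 / r) * (((k : ℝ) + 1) * (1 / 2) ^ k), ?_, ?_⟩
  · refine Summable.mul_left _ ?_
    have h1 := summable_pow_mul_geometric_of_norm_lt_one 1 (r := (1 / 2 : ℝ)) (by norm_num)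
    have h2 := summable_geometric_two
    simpa [add_mul] using h1.add h2
  rintro ⟨x, y⟩ ⟨hx, hy⟩
  have hx1 : x ∈ ball x₀ r₁ := ball_subset_ball ((min_le_left _ _).trans (min_le_left _ _)) hx
  have hx2 : x ∈ ball x₀ r₂ := ball_subset_ball ((min_le_left _ _).trans (min_le_right _ _)) hx
  have hy' : ‖y‖ ≤ r := by simpa using (mem_ball_zero_iff.1 hy).le
  have hfx := h₁ x hx1
  refine ⟨hfx, fun c k hc => ?_⟩
  have hG : ‖dIter ξ f k x‖ ≤ C * (K * M) ^ k * k ! := by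
    have := hKb f x hfx k 0
    rw [norm_iteratedFDeriv_zero, zero_add] at this
    calc _ ≤ K ^ k * (C * M ^ k * k !) := this.trans (by gcongr; exact h₂ x hx2 k)
      _ = _ := by rw [mul_pow]; ring
  have hG' : ‖fderiv ℝ (dIter ξ f k) x‖ ≤ C * (K * M) ^ k * k ! * (M * (k + 1)) := by
    have := hKb f x hfx k 1
    rw [norm_iteratedFDeriv_one, add_comm 1 k] at this
    calc _ ≤ K ^ k * (C * M ^ (k + 1) * (k + 1)!) := this.trans (by gcongr; exact h₂ x hx2 _)
      _ = _ := by rw [mul_pow, pow_succ, Nat.factorial_succ]; push_cast; ring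
  have hP := norm_ωCl_pow_le ξ hy' k
  have hP' := norm_fderiv_ωCl_pow_le ξ hr0 hy' k
  have hpow : (W * r) ^ k * (K * M) ^ k ≤ (1 / 2) ^ k := by
    rw [← mul_pow]; gcongr
  have hk0 : (0 : ℝ) < k ! := by positivity
  constructor
  · rw [serTerm, norm_smul, Real.norm_eq_abs]
    calc _ ≤ (k ! : ℝ)⁻¹ * ((N * (W * r) ^ k) * (C * (K * M) ^ k * k !)) := by
          gcongr
          exact (norm_mul_le _ _).trans (by gcongr)
      _ = N * C * ((W * r) ^ k * (K * M) ^ k) := by field_simp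
      _ ≤ N * C * 1 * ((1 : ℝ) * (1 / 2) ^ k) := by
          rw [one_mul, mul_one]; gcongr
      _ ≤ _ := by
          have h3 : (0:ℝ) ≤ 1 / r := by positivity
          beta_reduce
          gcongr <;> linarith [(Nat.cast_nonneg k : (0:ℝ) ≤ k)]
  · refine ContinuousLinearMap.opNorm_le_bound _ (by positivity) fun w => ?_
    rw [fderiv_serTerm_apply ξ c hfx, norm_smul, Real.norm_eq_abs]
    have e1 : ‖w.1‖ ≤ ‖w‖ := norm_fst_le w
    have e2 : ‖w.2‖ ≤ ‖w‖ := norm_snd_le w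
    calc _ ≤ (k ! : ℝ)⁻¹ * ((N * (W * r) ^ k) * ((C * (K * M) ^ k * k ! * (M * (k + 1))) * ‖w‖) +
            ((N / r * k * (W * r) ^ k) * ‖w‖) * (C * (K * M) ^ k * k !)) := by
          refine mul_le_mul hc ((norm_add_le _ _).trans (add_le_add ?_ ?_)) (norm_nonneg _)
            (by positivity)
          · refine (norm_mul_le _ _).trans (mul_le_mul hP ?_ (norm_nonneg _) (by positivity))
            exact (ContinuousLinearMap.le_opNorm _ _).trans (by gcongr)
          · refine (norm_mul_le _ _).trans (mul_le_mul ?_ hG (norm_nonneg _) (by positivity))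
            exact (ContinuousLinearMap.le_opNorm _ _).trans (by gcongr)
      _ = N * C * ((M * (k + 1) + 1 / r * k) * ((W * r) ^ k * (K * M) ^ k)) * ‖w‖ := by
          field_simp
      _ ≤ N * C * (((1 + M + 1 / r) * (k + 1)) * (1 / 2) ^ k) * ‖w‖ := by
          have h3 : (0:ℝ) ≤ 1 / r := by positivity
          gcongr
          nlinarith [(Nat.cast_nonneg k : (0:ℝ) ≤ k)]
      _ = _ := by ring

end Bounds

section Dirac

variable {p q : ℕ} {A : Type*} [NormedRing A] [NormedAlgebra ℝ A] (ξ : A ≃ₐ[ℝ] Cl (p + q))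

theorem fderiv_ωCl_pow_succ (k : ℕ) (y w : Vq q) :
    fderiv ℝ (fun y => ωCl p q ξ y ^ (k + 1)) y w =
      ωCl p q ξ w * ωCl p q ξ y ^ k +
        ωCl p q ξ y * fderiv ℝ (fun y => ωCl p q ξ y ^ k) y w := by
  have hd : HasFDerivAt (fun y => ωCl p q ξ y ^ k) (fderiv ℝ (fun y => ωCl p q ξ y ^ k) y) y :=
    ((hasFDerivAt_ωCl ξ y).differentiableAt.pow k).hasFDerivAt
  have h : HasFDerivAt (fun y => ωCl p q ξ y * ωCl p q ξ y ^ k) _ y :=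
    (hasFDerivAt_ωCl ξ y).mul' hd
  simp only [pow_succ']
  rw [h.fderiv]
  simp [ωCLM_apply, add_comm]

theorem fderiv_ωCl_pow_radial (k : ℕ) (r : ℝ) (v : Vq q) :
    fderiv ℝ (fun y => ωCl p q ξ y ^ (k + 1)) (r • v) v =
      (((k : ℝ) + 1) * r ^ k) • ωCl p q ξ v ^ (k + 1) := by
  induction k with
  | zero => rw [fderiv_ωCl_pow_succ]; simp
  | succ k ih =>
    rw [fderiv_ωCl_pow_succ, ih, ωCl_smul, smul_pow, mul_smul_comm, smul_mul_assoc, mul_smul_comm,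
      smul_smul, ← pow_succ', ← add_smul]
    congr 1
    push_cast
    ring

/-- The factor in `∂_{𝐱_q} 𝐱_q^{k+1} = -(diracConst q k) 𝐱_q^k`. -/
def diracConst (q k : ℕ) : ℝ := if k % 2 = 0 then k + q else k + 1

theorem diracConst_succ (q k : ℕ) :
    diracConst q (k + 1) = q + 2 * (k + 1) - diracConst q k := by
  unfold diracConst
  rcases Nat.mod_two_eq_zero_or_one k with h | h
  · have h' : (k + 1) % 2 = 1 := by omega
    simp only [h, h', if_true, one_ne_zero, if_false]; push_cast; ring
  · have h' : (k + 1) % 2 = 0 := by omega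
    simp only [h, h', if_true, one_ne_zero, if_false]; push_cast; ring

theorem diracConst_mul_gckConst (q k : ℕ) [NeZero q] :
    diracConst q k * gckConst q (k + 1) = gckConst q k := by
  obtain ⟨m, rfl | rfl⟩ := Nat.even_or_odd' k
  · rw [gckConst_even_eq, diracConst, if_pos (by omega)]; push_cast; rfl
  · rw [gckConst_odd_eq, diracConst, if_neg (by omega)]; push_cast; ring

theorem ωCl_single (j : Fin q) : ωCl p q ξ (EuclideanSpace.single j 1) = eQ p q ξ j := by
  simp [ωCl]

theorem sum_smul_fderiv_single {F : Type*} [NormedAddCommGroup F] [NormedSpace ℝ F]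
    (L : Vq q →L[ℝ] F) (y : Vq q) : ∑ j, y j • L (EuclideanSpace.single j 1) = L y := by
  have : y = ∑ j, y j • EuclideanSpace.single j (1 : ℝ) := by
    ext i; simp [Pi.single_apply]
  conv_rhs => rw [this]
  simp

theorem sum_eQ_mul_fderiv_ωCl_pow (k : ℕ) (y : Vq q) :
    ∑ j, eQ p q ξ j * fderiv ℝ (fun y => ωCl p q ξ y ^ (k + 1)) y (EuclideanSpace.single j 1) =
      -(diracConst q k • ωCl p q ξ y ^ k) := by
  induction k with
  | zero =>
    simp only [fderiv_ωCl_pow_succ, ωCl_single]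
    simp only [pow_zero, mul_one, fderiv_fun_const, Pi.zero_apply, zero_apply, mul_zero, add_zero,
      sum_eQ_mul_self]
    simp [diracConst, Nat.cast_smul_eq_nsmul]
  | succ k ih =>
    have hcomm : ∀ j, eQ p q ξ j * ωCl p q ξ y =
        -(ωCl p q ξ y * eQ p q ξ j) + (-2 * y j) • (1 : A) := by
      intro j
      have h := ωCl_mul_add ξ (EuclideanSpace.single j 1) y
      have hin : ⟪EuclideanSpace.single j (1 : ℝ), y⟫ = y j := by
        rw [EuclideanSpace.inner_single_left]; simp
      rw [ωCl_single, hin] at h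
      rw [← h]
      abel
    have hR := fderiv_ωCl_pow_radial ξ k 1 y
    rw [one_smul] at hR
    have hE := sum_smul_fderiv_single (fderiv ℝ (fun y => ωCl p q ξ y ^ (k + 1)) y) y
    rw [hR] at hE
    have h1 : ∀ j, eQ p q ξ j *
        fderiv ℝ (fun y => ωCl p q ξ y ^ (k + 1 + 1)) y (EuclideanSpace.single j 1) =
        (eQ p q ξ j * eQ p q ξ j) * ωCl p q ξ y ^ (k + 1) -
        ωCl p q ξ y * (eQ p q ξ j *
          fderiv ℝ (fun y => ωCl p q ξ y ^ (k + 1)) y (EuclideanSpace.single j 1)) +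
        (-2 : ℝ) • (y j •
          fderiv ℝ (fun y => ωCl p q ξ y ^ (k + 1)) y (EuclideanSpace.single j 1)) := by
      intro j
      rw [fderiv_ωCl_pow_succ, ωCl_single, mul_add, ← mul_assoc, ← mul_assoc, hcomm, add_mul,
        smul_mul_assoc, one_mul, mul_smul, neg_mul, mul_assoc (ωCl p q ξ y)]
      abel
    simp only [h1, Finset.sum_add_distrib, Finset.sum_sub_distrib, ← Finset.sum_mul,
      ← Finset.mul_sum, ← Finset.smul_sum, ih, hE, sum_eQ_mul_self]
    rw [diracConst_succ, mul_neg, mul_smul_comm, ← pow_succ', smul_smul]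
    have hq : -(q : A) * ωCl p q ξ y ^ (k + 1) = (-(q : ℝ)) • ωCl p q ξ y ^ (k + 1) := by
      rw [neg_mul, neg_smul, ← nsmul_eq_mul, Nat.cast_smul_eq_nsmul]
    rw [hq]
    module

end Dirac

/-- The zeroth order cancellation behind Cauchy–Kovalevskaya series. -/
theorem map_tsum_add_map_tsum_eq_zero {E F : Type*} [NormedAddCommGroup E] [NormedSpace ℝ E]
    [NormedAddCommGroup F] [NormedSpace ℝ F] {D : ℕ → E} (hD : Summable D) (L₁ L₂ : E →L[ℝ] F)
    (h0 : L₂ (D 0) = 0) (h : ∀ k, L₂ (D (k + 1)) = -L₁ (D k)) :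
    L₁ (∑' k, D k) + L₂ (∑' k, D k) = 0 := by
  rw [L₁.map_tsum hD, L₂.map_tsum hD, (hD.mapL L₂).tsum_eq_zero_add, h0, zero_add]
  simp only [h, tsum_neg, add_neg_cancel]

section Series

variable {p q : ℕ} {A : Type*} [NormedRing A] [NormedAlgebra ℝ A] (ξ : A ≃ₐ[ℝ] Cl (p + q))

/-- Boxes on which all the series under consideration are dominated, with their derivatives,
by one summable sequence. -/
def IsSerRadius (f : Vp p → A) (x₀ : Vp p) (r : ℝ) : Prop :=
  ∃ u : ℕ → ℝ, Summable u ∧ ∀ z ∈ ball x₀ r ×ˢ ball (0 : Vq q) r, AnalyticAt ℝ f z.1 ∧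
      ∀ c : ℕ → ℝ, ∀ k, |c k| ≤ (k ! : ℝ)⁻¹ →
        ‖serTerm ξ c f k z‖ ≤ u k ∧ ‖fderiv ℝ (serTerm ξ c f k) z‖ ≤ u k

theorem IsSerRadius.mono {f : Vp p → A} {x₀ : Vp p} {r s : ℝ} (h : IsSerRadius ξ f x₀ r)
    (hs : s ≤ r) : IsSerRadius ξ f x₀ s := by
  obtain ⟨u, hu, hb⟩ := h
  exact ⟨u, hu, fun z hz => hb z ⟨ball_subset_ball hs hz.1, ball_subset_ball hs hz.2⟩⟩

variable {f : Vp p → A} {x₀ : Vp p} {r : ℝ}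

theorem IsSerRadius.analyticAt (h : IsSerRadius ξ f x₀ r) {z : V p q}
    (hz : z ∈ ball x₀ r ×ˢ ball (0 : Vq q) r) : AnalyticAt ℝ f z.1 := by
  obtain ⟨u, -, hb⟩ := h
  exact (hb z hz).1

variable [CompleteSpace A] {c : ℕ → ℝ}

theorem IsSerRadius.summable (h : IsSerRadius ξ f x₀ r) (hc : ∀ k, |c k| ≤ (k ! : ℝ)⁻¹) {z : V p q}
    (hz : z ∈ ball x₀ r ×ˢ ball (0 : Vq q) r) : Summable fun k => serTerm ξ c f k z := by
  obtain ⟨u, hu, hb⟩ := h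
  exact .of_norm_bounded hu fun k => ((hb z hz).2 c k (hc k)).1

theorem IsSerRadius.summable_fderiv (h : IsSerRadius ξ f x₀ r) (hc : ∀ k, |c k| ≤ (k ! : ℝ)⁻¹)
    {z : V p q} (hz : z ∈ ball x₀ r ×ˢ ball (0 : Vq q) r) :
    Summable fun k => fderiv ℝ (serTerm ξ c f k) z := by
  obtain ⟨u, hu, hb⟩ := h
  exact .of_norm_bounded hu fun k => ((hb z hz).2 c k (hc k)).2

theorem isOpen_box (x₀ : Vp p) (r : ℝ) : IsOpen (ball x₀ r ×ˢ ball (0 : Vq q) r) :=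
  isOpen_ball.prod isOpen_ball

theorem IsSerRadius.hasFDerivAt (h : IsSerRadius ξ f x₀ r) (hc : ∀ k, |c k| ≤ (k ! : ℝ)⁻¹)
    {z : V p q} (hz : z ∈ ball x₀ r ×ˢ ball (0 : Vq q) r) :
    HasFDerivAt (fun z => ∑' k, serTerm ξ c f k z) (∑' k, fderiv ℝ (serTerm ξ c f k) z) z := by
  have hsum := h.summable ξ hc hz
  obtain ⟨u, hu, hb⟩ := h
  have hconn : IsPreconnected (ball x₀ r ×ˢ ball (0 : Vq q) r) :=
    (convex_ball x₀ r).isPreconnected.prod (convex_ball 0 r).isPreconnected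
  exact hasFDerivAt_tsum_of_isPreconnected (f := fun k => serTerm ξ c f k)
    (f' := fun k z => fderiv ℝ (serTerm ξ c f k) z) hu (isOpen_box x₀ r) hconn
    (fun k x hx => (analyticAt_serTerm ξ c (hb x hx).1 k).differentiableAt.hasFDerivAt)
    (fun k x hx => ((hb x hx).2 c k (hc k)).2) hz hsum hz

theorem IsSerRadius.contDiffOn (h : IsSerRadius ξ f x₀ r) (hc : ∀ k, |c k| ≤ (k ! : ℝ)⁻¹) :
    ContDiffOn ℝ 1 (fun z => ∑' k, serTerm ξ c f k z) (ball x₀ r ×ˢ ball (0 : Vq q) r) := by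
  rw [show (1 : WithTop ℕ∞) = 0 + 1 from rfl,
    contDiffOn_succ_iff_fderiv_of_isOpen (isOpen_box x₀ r)]
  refine ⟨fun z hz => (h.hasFDerivAt ξ hc hz).differentiableAt.differentiableWithinAt,
    by simp, ?_⟩
  rw [contDiffOn_zero]
  have hcongr : Set.EqOn (fderiv ℝ fun z => ∑' k, serTerm ξ c f k z)
      (fun z => ∑' k, fderiv ℝ (serTerm ξ c f k) z) (ball x₀ r ×ˢ ball (0 : Vq q) r) :=
    fun z hz => (h.hasFDerivAt ξ hc hz).fderiv
  refine ContinuousOn.congr ?_ hcongr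
  obtain ⟨u, hu, hb⟩ := h
  exact continuousOn_tsum
    (fun k z hz => (analyticAt_serTerm ξ c (hb z hz).1 k).fderiv.continuousAt.continuousWithinAt)
    hu fun k z hz => ((hb z hz).2 c k (hc k)).2

/-- The action of `D_{𝐱_p}` on differentials on `ℝ^{p+q+1}`. -/
def DPCLM : (V p q →L[ℝ] A) →L[ℝ] A :=
  ∑ i, (ContinuousLinearMap.mul ℝ A (εp p q ξ i)).comp
    (ContinuousLinearMap.apply ℝ A ((Pi.single i 1, 0) : V p q))

/-- The action of `∂_{𝐱_q}` on differentials on `ℝ^{p+q+1}`. -/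
def DQCLM : (V p q →L[ℝ] A) →L[ℝ] A :=
  ∑ j, (ContinuousLinearMap.mul ℝ A (eQ p q ξ j)).comp
    (ContinuousLinearMap.apply ℝ A ((0, EuclideanSpace.single j 1) : V p q))

theorem DPCLM_fderiv_serTerm (c : ℕ → ℝ) {z : V p q} (hf : AnalyticAt ℝ f z.1) (k : ℕ) :
    DPCLM ξ (fderiv ℝ (serTerm ξ c f k) z) =
      c k • (ωCl p q ξ z.2 ^ k * dIter ξ f (k + 1) z.1) := by
  rw [← sum_εp_mul ξ hf, Finset.smul_sum]
  simp [DPCLM, fderiv_serTerm_apply ξ c hf, pdP]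

theorem DQCLM_fderiv_serTerm_zero (c : ℕ → ℝ) {z : V p q} (hf : AnalyticAt ℝ f z.1) :
    DQCLM ξ (fderiv ℝ (serTerm ξ c f 0) z) = 0 := by
  simp [DQCLM, fderiv_serTerm_apply ξ c hf]

theorem DQCLM_fderiv_serTerm_succ (c : ℕ → ℝ) {z : V p q} (hf : AnalyticAt ℝ f z.1) (k : ℕ) :
    DQCLM ξ (fderiv ℝ (serTerm ξ c f (k + 1)) z) =
      -((diracConst q k * c (k + 1)) • (ωCl p q ξ z.2 ^ k * dIter ξ f (k + 1) z.1)) := by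
  have h := sum_eQ_mul_fderiv_ωCl_pow ξ k z.2
  have : DQCLM ξ (fderiv ℝ (serTerm ξ c f (k + 1)) z) = c (k + 1) •
      ((∑ j, eQ p q ξ j * fderiv ℝ (fun y => ωCl p q ξ y ^ (k + 1)) z.2
        (EuclideanSpace.single j 1)) * dIter ξ f (k + 1) z.1) := by
    rw [Finset.sum_mul, Finset.smul_sum]
    simp [DQCLM, fderiv_serTerm_apply ξ c hf, mul_assoc]
  rw [this, h, neg_mul, smul_neg, smul_mul_assoc, smul_smul, mul_comm]

theorem IsSerRadius.DV_eq_zero [NeZero q] (h : IsSerRadius ξ f x₀ r) {z : V p q}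
    (hz : z ∈ ball x₀ r ×ˢ ball (0 : Vq q) r) :
    DV p q ξ (fun z => ∑' k, serTerm ξ (gckConst q) f k z) z = 0 := by
  have hc : ∀ k, |gckConst q k| ≤ (k ! : ℝ)⁻¹ := fun k => by
    rw [abs_of_nonneg (gckConst_nonneg q k)]; exact gckConst_le k
  have hf := h.analyticAt ξ hz
  have := map_tsum_add_map_tsum_eq_zero (h.summable_fderiv ξ hc hz) (DPCLM ξ) (DQCLM ξ)
    (DQCLM_fderiv_serTerm_zero ξ _ hf) fun k => by
      rw [DPCLM_fderiv_serTerm ξ _ hf, DQCLM_fderiv_serTerm_succ ξ _ hf, diracConst_mul_gckConst]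
  rw [← this, DV]
  simp only [pdV1, pdV2, (h.hasFDerivAt ξ hc hz).fderiv]
  simp [DPCLM, DQCLM]

theorem norm_eq_one_of_mem_S {v : Vq q} (hv : v ∈ S q) : ‖v‖ = 1 := by
  rw [EuclideanSpace.norm_eq, show ∑ j, ‖v j‖ ^ 2 = 1 by simpa [S] using hv, Real.sqrt_one]

/-- The linear map `spt`. -/
def sptCLM (v : Vq q) : Sl p →L[ℝ] V p q :=
  (ContinuousLinearMap.fst ℝ (Vp p) ℝ).prod
    ((ContinuousLinearMap.snd ℝ (Vp p) ℝ).smulRight v)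

theorem IsSerRadius.slice_eq_zero (h : IsSerRadius ξ f x₀ r) {v : Vq q} (hv : v ∈ S q) {z : Sl p}
    (hz : spt p q v z ∈ ball x₀ r ×ˢ ball (0 : Vq q) r) :
    DP p q ξ (fun w => ∑' k, serTerm ξ (fun k => (k ! : ℝ)⁻¹) f k (spt p q v w)) z +
      ωCl p q ξ v *
        pdr p (fun w => ∑' k, serTerm ξ (fun k => (k ! : ℝ)⁻¹) f k (spt p q v w)) z = 0 := by
  set c : ℕ → ℝ := fun k => (k ! : ℝ)⁻¹ with hcdef
  have hc : ∀ k, |c k| ≤ (k ! : ℝ)⁻¹ := fun k => (abs_of_nonneg (by positivity)).le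
  have hf : AnalyticAt ℝ f z.1 := h.analyticAt ξ hz
  have hω : ωCl p q ξ v * ωCl p q ξ v = -1 := by
    rw [ωCl_sq, norm_eq_one_of_mem_S hv]; simp
  have hfd : fderiv ℝ (fun w => ∑' k, serTerm ξ c f k (spt p q v w)) z =
      (∑' k, fderiv ℝ (serTerm ξ c f k) (spt p q v z)).comp (sptCLM v) :=
    ((h.hasFDerivAt ξ hc hz).comp z ((sptCLM v).hasFDerivAt (x := z))).fderiv
  have hL : ∀ k, fderiv ℝ (serTerm ξ c f k) (spt p q v z) ((0, v) : V p q) =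
      c k • (fderiv ℝ (fun y => ωCl p q ξ y ^ k) (z.2 • v) v * dIter ξ f k z.1) := by
    intro k
    rw [fderiv_serTerm_apply ξ c hf]
    simp [spt]
  have := map_tsum_add_map_tsum_eq_zero (h.summable_fderiv ξ hc hz) (DPCLM ξ)
    ((ContinuousLinearMap.mul ℝ A (ωCl p q ξ v)).comp
      (ContinuousLinearMap.apply ℝ A ((0, v) : V p q)))
    (by simp [hL]) fun k => by
      rw [DPCLM_fderiv_serTerm ξ _ (by exact hf)]
      simp only [ContinuousLinearMap.comp_apply, ContinuousLinearMap.apply_apply,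
        ContinuousLinearMap.mul_apply', hL, fderiv_ωCl_pow_radial]
      simp only [spt, ωCl_smul, smul_pow, smul_mul_assoc, mul_smul_comm, smul_smul]
      rw [pow_succ', mul_assoc (ωCl p q ξ v) (ωCl p q ξ v ^ k),
        ← mul_assoc (ωCl p q ξ v) (ωCl p q ξ v) _, hω, neg_one_mul, smul_neg]
      congr 2
      simp only [hcdef, Nat.factorial_succ]
      push_cast
      field_simp
  rw [← this, DP]
  simp only [pdSl, pdr, hfd]
  simp [DPCLM, sptCLM]

end Series

section Average

variable {p q : ℕ} {A : Type*} [NormedRing A] [NormedAlgebra ℝ A] (ξ : A ≃ₐ[ℝ] Cl (p + q))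

theorem CKext_eq [CompleteSpace A] {f : Vp p → A} {z : V p q} (hf : AnalyticAt ℝ f z.1) :
    CKext p q ξ f z = ∑' k, serTerm ξ (fun k => (k ! : ℝ)⁻¹) f k z :=
  tsum_congr fun k => ckTerm_eq ξ hf k

theorem CKdir_eq [CompleteSpace A] {f : Vp p → A} {z : V p q} (hf : AnalyticAt ℝ f z.1)
    (w : Vq q) : CKdir p q ξ w f z = CKext p q ξ f (z.1, ⟪w, z.2⟫ • w) :=
  tsum_congr fun k => ckDirTerm_eq ξ hf w k

theorem GCKext_eq (f : Vp p → A) :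
    GCKext p q ξ f = fun z => ∑' k, serTerm ξ (gckConst q) f k z :=
  funext fun z => tsum_congr fun k => gckTerm_eq ξ f k z

theorem continuous_ωCl : Continuous (ωCl p q ξ) :=
  continuous_iff_continuousAt.2 fun v => (hasFDerivAt_ωCl ξ v).continuousAt

theorem serTerm_radial (c : ℕ → ℝ) (f : Vp p → A) (k : ℕ) (x : Vp p) (s : ℝ) (w : Vq q) :
    serTerm ξ c f k (x, s • w) = c k • ((s ^ k • ωCl p q ξ w ^ k) * dIter ξ f k x) := by
  rw [serTerm, ωCl_smul, smul_pow]

variable [CompleteSpace A]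

theorem average_mul_const {f : sphere (0 : Vq q) 1 → A} (hf : Integrable f (sphMeasure q)) (a : A) :
    ⨍ w, f w * a ∂(sphMeasure q) = (⨍ w, f w ∂(sphMeasure q)) * a := by
  have h := ((ContinuousLinearMap.mul ℝ A).flip a).integral_comp_comm hf
  simp only [ContinuousLinearMap.flip_apply, ContinuousLinearMap.mul_apply'] at h
  rw [average_eq, average_eq, h, smul_mul_assoc]

variable [NeZero q]

theorem average_inner_pow_smul_ωCl_pow (k : ℕ) (y : Vq q) :
    ⨍ w : sphere (0 : Vq q) 1, ⟪(w : Vq q), y⟫ ^ k • ωCl p q ξ w ^ k ∂(sphMeasure q) =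
      (k ! * gckConst q k) • ωCl p q ξ y ^ k := by
  have hw : ∀ w : sphere (0 : Vq q) 1, ‖(w : Vq q)‖ = 1 := fun w => mem_sphere_zero_iff_norm.1 w.2
  obtain ⟨m, rfl | rfl⟩ := Nat.even_or_odd' k
  · have h := average_inner_even_pow m y
    rw [average_eq, smul_eq_mul] at h
    simp only [ωCl_pow_even, hw]
    rw [average_eq, integral_smul_const, smul_smul, h, factorial_mul_gckConst_even, smul_smul,
      smul_smul, one_pow, neg_pow (‖y‖ ^ 2) m, ← pow_mul]
    congr 1
    ring
  · have h := fun j => average_inner_odd_pow_mul m y (EuclideanSpace.single j 1)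
    simp only [average_eq, smul_eq_mul] at h
    have hin : ∀ (x : Vq q) (j : Fin q), ⟪x, EuclideanSpace.single j (1 : ℝ)⟫ = x j := by
      intro x j
      rw [EuclideanSpace.inner_single_right]; simp
    simp only [hin] at h
    have e1 : ∀ w : sphere (0 : Vq q) 1,
        ⟪(w : Vq q), y⟫ ^ (2 * m + 1) • ωCl p q ξ w ^ (2 * m + 1) =
        ∑ j, (⟪(w : Vq q), y⟫ ^ (2 * m + 1) * (w : Vq q) j) • ((-1 : ℝ) ^ m • eQ p q ξ j) := by
      intro w
      rw [ωCl_pow_odd, hw, one_pow, ωCl, Finset.smul_sum, Finset.smul_sum]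
      refine Finset.sum_congr rfl fun j _ => ?_
      simp only [smul_smul]
      congr 1
      ring
    simp only [e1]
    rw [average_eq, integral_finsetSum _ fun j _ => integrable_sphMeasure (by fun_prop),
      Finset.smul_sum]
    rw [factorial_mul_gckConst_odd, ωCl_pow_odd, ωCl, smul_smul, Finset.smul_sum]
    refine Finset.sum_congr rfl fun j _ => ?_
    rw [integral_smul_const, smul_smul, h, smul_smul, smul_smul]
    congr 1
    rw [neg_pow (‖y‖ ^ 2) m, ← pow_mul]
    ring

theorem IsSerRadius.average_eq {f : Vp p → A} {x₀ : Vp p} {r : ℝ} (h : IsSerRadius ξ f x₀ r)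
    {z : V p q} (hz : z ∈ ball x₀ r ×ˢ ball (0 : Vq q) r) :
    ⨍ w : sphere (0 : Vq q) 1, CKext p q ξ f (z.1, ⟪(w : Vq q), z.2⟫ • (w : Vq q))
      ∂(sphMeasure q) = GCKext p q ξ f z := by
  have hf := h.analyticAt ξ hz
  obtain ⟨u, hu, hb⟩ := h
  set T : ℕ → sphere (0 : Vq q) 1 → A := fun k w =>
    serTerm ξ (fun k => (k ! : ℝ)⁻¹) f k (z.1, ⟪(w : Vq q), z.2⟫ • (w : Vq q)) with hT
  have hbox : ∀ w : sphere (0 : Vq q) 1,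
      ((z.1, ⟪(w : Vq q), z.2⟫ • (w : Vq q)) : V p q) ∈ ball x₀ r ×ˢ ball (0 : Vq q) r := by
    intro w
    have hw : ‖(w : Vq q)‖ = 1 := mem_sphere_zero_iff_norm.1 w.2
    refine ⟨hz.1, ?_⟩
    have h1 := abs_real_inner_le_norm (w : Vq q) z.2
    have h2 := mem_ball_zero_iff.1 hz.2
    rw [mem_ball_zero_iff, norm_smul, hw, mul_one, Real.norm_eq_abs]
    rw [hw, one_mul] at h1
    exact h1.trans_lt h2
  have hTu : ∀ k w, ‖T k w‖ ≤ u k := fun k w =>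
    ((hb _ (hbox w)).2 _ k (abs_of_nonneg (by positivity)).le).1
  have hω := continuous_ωCl ξ
  have hcont : ∀ k, Continuous fun w : sphere (0 : Vq q) 1 =>
      ⟪(w : Vq q), z.2⟫ ^ k • ωCl p q ξ (w : Vq q) ^ k := fun k => by fun_prop
  have hTeq : ∀ k w, T k w = (k ! : ℝ)⁻¹ •
      ((⟪(w : Vq q), z.2⟫ ^ k • ωCl p q ξ (w : Vq q) ^ k) * dIter ξ f k z.1) := fun k w =>
    serTerm_radial ξ _ f k z.1 _ _
  have hTint : ∀ k, Integrable (T k) (sphMeasure q) := fun k => by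
    simp only [funext (hTeq k)]
    exact integrable_sphMeasure (((hcont k).mul continuous_const).const_smul _)
  have hsum : Summable fun k => ∫ w, ‖T k w‖ ∂(sphMeasure q) := by
    refine Summable.of_nonneg_of_le (fun k => integral_nonneg fun w => norm_nonneg _) (fun k => ?_)
      (hu.mul_left ((sphMeasure q).real Set.univ))
    calc _ ≤ ∫ _, u k ∂(sphMeasure q) :=
          integral_mono (hTint k).norm (integrable_const _) fun w => hTu k w
      _ = _ := by rw [integral_const, smul_eq_mul]
  have hCK : ∀ w : sphere (0 : Vq q) 1,
      CKext p q ξ f (z.1, ⟪(w : Vq q), z.2⟫ • (w : Vq q)) = ∑' k, T k w := fun w =>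
    CKext_eq ξ (by exact hf)
  simp only [hCK]
  rw [MeasureTheory.average_eq, ← integral_tsum_of_summable_integral_norm hTint hsum,
    ← tsum_const_smul'']
  refine tsum_congr fun k => ?_
  rw [← MeasureTheory.average_eq]
  simp only [hTeq]
  rw [MeasureTheory.average_eq, integral_smul, smul_comm, ← MeasureTheory.average_eq,
    average_mul_const (integrable_sphMeasure (hcont k)), average_inner_pow_smul_ωCl_pow,
    gckTerm_eq, smul_mul_assoc, smul_smul, inv_mul_cancel_left₀ (by positivity)]

end Average

section Domain

/-- The union of the boxes of size `r x` centered at the points `(x, 0)`, `x ∈ s`. -/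
def boxUnion {E : Type*} (F : Type*) [NormedAddCommGroup E] [NormedAddCommGroup F] (s : Set E)
    (r : E → ℝ) : Set (E × F) :=
  {z | ∃ x ∈ s, z ∈ ball x (r x) ×ˢ ball (0 : F) (r x)}

theorem isDomain_boxUnion {E F : Type*} [NormedAddCommGroup E] [NormedSpace ℝ E]
    [NormedAddCommGroup F] [NormedSpace ℝ F] {s : Set E} (hs : IsConnected s) {r : E → ℝ}
    (hr : ∀ x ∈ s, 0 < r x) : IsDomain (boxUnion F s r) := by
  have hz : ∀ x ∈ s, ((x, 0) : E × F) ∈ boxUnion F s r := fun x hx =>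
    ⟨x, hx, mem_ball_self (hr x hx), mem_ball_self (hr x hx)⟩
  refine ⟨?_, ?_, ?_⟩
  · have : boxUnion F s r = ⋃ x ∈ s, ball x (r x) ×ˢ ball (0 : F) (r x) := by
      ext z; simp [boxUnion, and_left_comm]
    rw [this]
    exact isOpen_biUnion fun x _ => isOpen_ball.prod isOpen_ball
  · obtain ⟨x, hx⟩ := hs.nonempty
    exact ⟨_, hz x hx⟩
  · obtain ⟨a, ha⟩ := hs.nonempty
    refine isPreconnected_of_forall ((a, 0) : E × F) fun y hy => ?_
    obtain ⟨x, hx, hyx⟩ := hy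
    refine ⟨s ×ˢ {0} ∪ ball x (r x) ×ˢ ball (0 : F) (r x), ?_, Or.inl ⟨ha, rfl⟩, Or.inr hyx, ?_⟩
    · rintro ⟨b, c⟩ (⟨hb, rfl⟩ | h)
      · exact hz b hb
      · exact ⟨x, hx, h⟩
    · exact IsPreconnected.union (x, 0) ⟨hx, rfl⟩
        ⟨mem_ball_self (hr x hx), mem_ball_self (hr x hx)⟩
        (hs.isPreconnected.prod isPreconnected_singleton)
        ((convex_ball _ _).isPreconnected.prod (convex_ball _ _).isPreconnected)

variable {p q : ℕ}

theorem isPSymmetric_boxUnion (s : Set (Vp p)) (r : Vp p → ℝ) :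
    IsPSymmetric p q (boxUnion (Vq q) s r) := by
  rintro x t v hv w hw ⟨a, ha, hx, hy⟩
  refine ⟨a, ha, hx, ?_⟩
  simpa [norm_smul, norm_eq_one_of_mem_S hv, norm_eq_one_of_mem_S hw] using hy

theorem sliceSet_boxUnion (s : Set (Vp p)) (r : Vp p → ℝ) {v : Vq q} (hv : v ∈ S q) :
    sliceSet p q (boxUnion (Vq q) s r) v = boxUnion ℝ s r := by
  ext z
  simp [sliceSet, boxUnion, spt, norm_smul, norm_eq_one_of_mem_S hv]

end Domain

end GPS

/-- **GCK via the dual Radon transform** (Theorem 5.4).  For a real analytic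
`f₀ : Ω₀ → ℝ_{p+q}` on a domain `Ω₀ ⊆ ℝ^{p+1}`, on a p-symmetric slice domain
`Ω ⊆ Ω₀*` containing `Ω₀` one has
`GCK[f₀] = (1/A_q) ∫_𝕊 CK[f₀, η] dS(η) = Ř[CK[f₀]]`, i.e. `GCK = Ř ∘ CK`; in
particular the dual Radon transform maps the slice CK-extension
`CK[f₀] ∈ 𝒢𝒮ℳ(Ω)` to the axially monogenic generalized CK-extension `GCK[f₀]`. -/
theorem GCK_eq_dualRadon_CK
    (p q : ℕ) (hq : 1 ≤ q) {A : Type*} [NormedRing A] [NormedAlgebra ℝ A]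
    [CompleteSpace A]
    (ξ : A ≃ₐ[ℝ] Cl (p + q))
    (Ω₀ : Set (Vp p)) (hΩ₀ : IsDomain Ω₀)
    (f₀ : Vp p → A) (hf₀ : AnalyticOnNhd ℝ f₀ Ω₀) :
    ∃ Ω : Set (V p q), IsPSymmetric p q Ω ∧ IsSliceDomain p q Ω ∧
      Ω ⊆ star0 p q Ω₀ ∧ (∀ x ∈ Ω₀, ((x, 0) : V p q) ∈ Ω) ∧
      GSMOn p q ξ Ω (CKext p q ξ f₀) ∧
      (∀ z ∈ Ω, HasSum (fun k => gckTerm p q ξ f₀ k z) (GCKext p q ξ f₀ z)) ∧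
      (∀ z ∈ Ω, GCKext p q ξ f₀ z
          = ⨍ w : sphere (0 : Vq q) 1, CKdir p q ξ (w : Vq q) f₀ z ∂(sphMeasure q)) ∧
      (∀ z ∈ Ω, GCKext p q ξ f₀ z = dualRadon p q (CKext p q ξ f₀) z) ∧
      MonogenicOn p q ξ Ω (GCKext p q ξ f₀) := by
  have : NeZero q := ⟨by omega⟩
  have hex : ∀ x ∈ Ω₀, ∃ r > 0, IsSerRadius ξ f₀ x r ∧ ball x r ⊆ Ω₀ := by
    intro x hx
    obtain ⟨r₁, hr₁, h₁⟩ := exists_bound_serTerm ξ (hf₀ x hx)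
    obtain ⟨r₂, hr₂, h₂⟩ := Metric.isOpen_iff.1 hΩ₀.1 x hx
    exact ⟨min r₁ r₂, lt_min hr₁ hr₂, IsSerRadius.mono ξ h₁ (min_le_left _ _),
      (ball_subset_ball (min_le_right _ _)).trans h₂⟩
  choose! r hr0 hser hball using hex
  have hg : ∀ k, |gckConst q k| ≤ (k ! : ℝ)⁻¹ := fun k => by
    rw [abs_of_nonneg (gckConst_nonneg q k)]; exact gckConst_le k
  have hc : ∀ k : ℕ, |(k ! : ℝ)⁻¹| ≤ (k ! : ℝ)⁻¹ := fun k => (abs_of_nonneg (by positivity)).le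
  have hz0 : ∀ x ∈ Ω₀, ((x, 0) : V p q) ∈ boxUnion (Vq q) Ω₀ r := fun x hx =>
    ⟨x, hx, mem_ball_self (hr0 x hx), mem_ball_self (hr0 x hx)⟩
  have hdom := isDomain_boxUnion (F := Vq q) hΩ₀.2 hr0
  have hsub : ∀ z ∈ boxUnion (Vq q) Ω₀ r, z.1 ∈ Ω₀ := by
    rintro z ⟨x, hx, hz⟩
    exact hball x hx hz.1
  have havg : ∀ z ∈ boxUnion (Vq q) Ω₀ r,
      GCKext p q ξ f₀ z = dualRadon p q (CKext p q ξ f₀) z := by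
    rintro z ⟨x, hx, hz⟩
    exact ((hser x hx).average_eq ξ hz).symm
  refine ⟨boxUnion (Vq q) Ω₀ r, isPSymmetric_boxUnion Ω₀ r, ⟨hdom, ?_, fun v hv => ?_⟩, hsub, hz0,
    fun v hv => ?_, ?_, fun z hz => ?_, havg, ?_, ?_⟩
  · obtain ⟨x, hx⟩ := hΩ₀.2.nonempty
    exact ⟨x, hz0 x hx⟩
  · rw [sliceSet_boxUnion Ω₀ r hv]
    exact isDomain_boxUnion hΩ₀.2 hr0
  · have hopen : IsOpen (sliceSet p q (boxUnion (Vq q) Ω₀ r) v) := by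
      rw [sliceSet_boxUnion Ω₀ r hv]
      exact (isDomain_boxUnion hΩ₀.2 hr0).1
    have heq : Set.EqOn (fun z => CKext p q ξ f₀ (spt p q v z))
        (fun z => ∑' k, serTerm ξ (fun k => (k ! : ℝ)⁻¹) f₀ k (spt p q v z))
        (sliceSet p q (boxUnion (Vq q) Ω₀ r) v) := fun z hz => CKext_eq ξ (hf₀ _ (hsub _ hz))
    refine ⟨ContDiffOn.congr (fun z hz => ?_) heq, fun z hz => ?_⟩
    · obtain ⟨x, hx, hzx⟩ := hz
      have h1 := ((hser x hx).contDiffOn ξ hc).contDiffAt ((isOpen_box x (r x)).mem_nhds hzx)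
      exact (h1.comp z (sptCLM v).contDiff.contDiffAt).contDiffWithinAt
    · have he := (heq.eventuallyEq_of_mem (hopen.mem_nhds hz)).fderiv_eq (𝕜 := ℝ)
      obtain ⟨x, hx, hzx⟩ := hz
      rw [← (hser x hx).slice_eq_zero ξ hv hzx]
      simp only [DP, pdSl, pdr, he]
  · rintro z ⟨x, hx, hz⟩
    have h := ((hser x hx).summable ξ hg hz).hasSum
    simp only [GCKext_eq]
    exact h.congr_fun fun k => gckTerm_eq ξ f₀ k z
  · rw [havg z hz, dualRadon]
    simp only [CKdir_eq ξ (hf₀ _ (hsub z hz))]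
  · rw [GCKext_eq]
    rintro z ⟨x, hx, hz⟩
    exact (((hser x hx).contDiffOn ξ hg).contDiffAt
      ((isOpen_box x (r x)).mem_nhds hz)).contDiffWithinAt
  · rw [GCKext_eq]
    rintro z ⟨x, hx, hz⟩
    exact (hser x hx).DV_eq_zero ξ hz
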